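/- Let (X,d) be a complete separable metric space in which closed balls are compact, let α be a Young function satisfying the Δ₂-condition, and let μ be a probability measure on X satisfying the transport-entropy inequality T_α(C) for some C > 0. Then for every bounded measurable function φ : X → ℝ, the probability measure d\tilde{μ} = (1/Z) e^{φ} dμ (Z the normalization constant) satisfies T_α( \tilde{C} ) with \tilde{C} = \tilde{κ}_{p_α} · C · e^{(p_α−1)·Osc(φ)}, where Osc(φ) = sup φ − inf φ and \tilde{κ}_{p_α} = p_α^{p_α²} / (p_α−1)^{p_α(p_α−1)}. -/

import Mathlib

open MeasureTheory Filter Set Topology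
open scoped ENNReal NNReal

noncomputable section

/-- The right derivative of a function `α : ℝ → ℝ`. -/
def rightD (α : ℝ → ℝ) (x : ℝ) : ℝ := derivWithin α (Set.Ioi x) x

/-- The left derivative of a function `α : ℝ → ℝ`. -/
def leftD (α : ℝ → ℝ) (x : ℝ) : ℝ := derivWithin α (Set.Iio x) x

/-- A Young function: an even, convex, nonnegative function, increasing on `[0,∞)`,
vanishing at `0` and with vanishing right derivative at `0`. -/
structure IsYoung (α : ℝ → ℝ) : Prop where
  nonneg : ∀ x, 0 ≤ α x
  even : ∀ x, α (-x) = α x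
  convex : ConvexOn ℝ Set.univ α
  mono : StrictMonoOn α (Set.Ici 0)
  zero : α 0 = 0
  rightD_zero : rightD α 0 = 0

/-- The Δ₂-condition for a Young function. -/
def DeltaTwo (α : ℝ → ℝ) : Prop := ∃ K > 0, ∀ x : ℝ, α (2 * x) ≤ K * α x

/-- `r_α = inf_{x>0} x α'₋(x)/α(x)`. -/
def rAlpha (α : ℝ → ℝ) : ℝ := sInf {r : ℝ | ∃ x > 0, r = x * leftD α x / α x}

/-- `p_α = sup_{x>0} x α'₊(x)/α(x)`. -/
def pAlpha (α : ℝ → ℝ) : ℝ := sSup {r : ℝ | ∃ x > 0, r = x * rightD α x / α x}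

/-- The Fenchel-Legendre transform `α*(y) = sup_x {xy - α(x)}`, with values in `[0,∞]`. -/
def legendre (α : ℝ → ℝ) (y : ℝ) : ℝ≥0∞ := ⨆ x : ℝ, ENNReal.ofReal (x * y - α x)

/-- `ξ_α(t) = sup_{u>0} α*(t α'₊(u)) / (t α(u))`. -/
def xiAlpha (α : ℝ → ℝ) (t : ℝ) : ℝ≥0∞ :=
  ⨆ u : {u : ℝ // 0 < u}, legendre α (t * rightD α u) / ENNReal.ofReal (t * α u)

/-- A bounded real-valued function. -/
def IsBoundedFun {Y : Type*} (f : Y → ℝ) : Prop := ∃ M, ∀ x, |f x| ≤ M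

variable {X : Type*} [MetricSpace X] [MeasurableSpace X]

/-- The optimal transport cost `T_α(ν,μ)` between two measures, for the cost
function `(x,y) ↦ α(d(x,y))`. -/
def transportCost (α : ℝ → ℝ) (ν μ : Measure X) : ℝ≥0∞ :=
  sInf { c : ℝ≥0∞ | ∃ π : Measure (X × X), π.map Prod.fst = ν ∧ π.map Prod.snd = μ ∧
      c = ∫⁻ z, ENNReal.ofReal (α (dist z.1 z.2)) ∂π }

open Classical in
/-- The relative entropy `H(ν|μ) = ∫ log (dν/dμ) dν` if `ν ≪ μ` (and `+∞` if `ν` is not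
absolutely continuous with respect to `μ`, or if the integral diverges). -/
def relEnt (ν μ : Measure X) : ℝ≥0∞ :=
  if ν ≪ μ ∧ Integrable (fun x => Real.log (ν.rnDeriv μ x).toReal) ν
  then ENNReal.ofReal (∫ x, Real.log (ν.rnDeriv μ x).toReal ∂ν) else ⊤

/-- The transport-entropy inequality `T_α(C)`: for every probability measure `ν`,
`T_α(ν,μ) ≤ C H(ν|μ)`. -/
def TransportEntropy (μ : Measure X) (α : ℝ → ℝ) (C : ℝ) : Prop :=
  ∀ ν : Measure X, IsProbabilityMeasure ν →
    transportCost α ν μ ≤ ENNReal.ofReal C * relEnt ν μ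

/-- The entropy functional `Ent_μ(e^f)`. -/
def entExp (μ : Measure X) (f : X → ℝ) : ℝ :=
  ∫ x, Real.exp (f x) * Real.log (Real.exp (f x)) ∂μ
    - (∫ x, Real.exp (f x) ∂μ) * Real.log (∫ x, Real.exp (f x) ∂μ)

/-- `|∇⁺ f|(x) = limsup_{y → x} [f(y) - f(x)]₊ / d(y,x)` (equal to `0` at isolated
points by the conventions on `limsup` and `sInf` in `ℝ`). -/
def gradPlus (f : X → ℝ) (x : X) : ℝ :=
  limsup (fun y => max (f y - f x) 0 / dist y x) (𝓝[≠] x)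

/-- `|∇⁻ f|(x) = limsup_{y → x} [f(y) - f(x)]₋ / d(y,x)` (equal to `0` at isolated
points by the conventions on `limsup` and `sInf` in `ℝ`). -/
def gradMinus (f : X → ℝ) (x : X) : ℝ :=
  limsup (fun y => max (-(f y - f x)) 0 / dist y x) (𝓝[≠] x)

/-- The modified log-Sobolev inequality plus `LSI⁺_α(A)`. -/
def LSIplus (μ : Measure X) (α : ℝ → ℝ) (A : ℝ) : Prop :=
  ∀ f : X → ℝ, IsBoundedFun f → LocallyLipschitz f →
    ENNReal.ofReal (entExp μ f) ≤
      ENNReal.ofReal A * ∫⁻ x, legendre α (gradPlus f x) * ENNReal.ofReal (Real.exp (f x)) ∂μ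

/-- The modified log-Sobolev inequality minus `LSI⁻_α(A)`. -/
def LSIminus (μ : Measure X) (α : ℝ → ℝ) (A : ℝ) : Prop :=
  ∀ f : X → ℝ, IsBoundedFun f → LocallyLipschitz f →
    ENNReal.ofReal (entExp μ f) ≤
      ENNReal.ofReal A * ∫⁻ x, legendre α (gradMinus f x) * ENNReal.ofReal (Real.exp (f x)) ∂μ

/-- The inf-convolution operator `Q_α^λ f(x) = inf_y {f(y) + λ α(d(x,y))}`. -/
def QInf (α : ℝ → ℝ) (lam : ℝ) (f : X → ℝ) (x : X) : ℝ :=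
  ⨅ y : X, (f y + lam * α (dist x y))

/-- The `(τ)`-log-Sobolev inequality `(τ)-LSI_α(λ, A)`. -/
def TauLSI (μ : Measure X) (α : ℝ → ℝ) (lam A : ℝ) : Prop :=
  ∀ f : X → ℝ, IsBoundedFun f → LocallyLipschitz f →
    entExp μ f ≤ A * ∫ x, (f x - QInf α lam f x) * Real.exp (f x) ∂μ

/-- The `n`-dimensional inf-convolution operator
`Q_{α,n} f(x) = inf_y {f(y) + Σᵢ α(d(xᵢ,yᵢ))}`. -/
def QInfN (α : ℝ → ℝ) {n : ℕ} (f : (Fin n → X) → ℝ) (x : Fin n → X) : ℝ :=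
  ⨅ y : Fin n → X, (f y + ∑ i, α (dist (x i) (y i)))

/-- The `n`-dimensional sup-convolution operator
`P_{α,n} f(x) = sup_y {f(y) - Σᵢ α(d(xᵢ,yᵢ))}`. -/
def PSupN (α : ℝ → ℝ) {n : ℕ} (f : (Fin n → X) → ℝ) (x : Fin n → X) : ℝ :=
  ⨆ y : Fin n → X, (f y - ∑ i, α (dist (x i) (y i)))

end

namespace IsYoung

variable {α : ℝ → ℝ}

lemma continuous (hα : IsYoung α) : Continuous α :=
  continuousOn_univ.1 (hα.convex.continuousOn isOpen_univ)

lemma le_of_le (hα : IsYoung α) {x y : ℝ} (hx : 0 ≤ x) (hxy : x ≤ y) : α x ≤ α y :=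
  hα.mono.monotoneOn hx (hx.trans hxy) hxy

lemma pos (hα : IsYoung α) {x : ℝ} (hx : 0 < x) : 0 < α x := by
  simpa [hα.zero] using hα.mono (mem_Ici.2 le_rfl) (mem_Ici.2 hx.le) hx

lemma hasDerivWithinAt_rightD (hα : IsYoung α) (x : ℝ) :
    HasDerivWithinAt α (rightD α x) (Ioi x) x :=
  hα.convex.hasDerivWithinAt_rightDeriv_of_mem_interior (by simp)

/-- Under the `Δ₂`-condition the supremum defining `pAlpha` is finite, hence an upper bound. -/
lemma mul_rightD_le (hα : IsYoung α) (hΔ : DeltaTwo α) {x : ℝ} (hx : 0 < x) :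
    x * rightD α x ≤ pAlpha α * α x := by
  obtain ⟨K, -, hK⟩ := hΔ
  have hbdd : BddAbove {r : ℝ | ∃ x > 0, r = x * rightD α x / α x} := by
    refine ⟨K, ?_⟩
    rintro r ⟨x, hx, rfl⟩
    rw [div_le_iff₀ (hα.pos hx)]
    have h := hα.convex.rightDeriv_le_slope_of_mem_interior (x := x) (y := 2 * x)
      (by simp) (mem_univ _) (by linarith)
    rw [slope_def_field, le_div_iff₀ (by linarith)] at h
    have h' : rightD α x * (2 * x - x) ≤ α (2 * x) - α x := h
    nlinarith [hK x, hα.nonneg x]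
  have := le_csSup hbdd ⟨x, hx, rfl⟩
  rwa [div_le_iff₀ (hα.pos hx)] at this

lemma growth (hα : IsYoung α) (hΔ : DeltaTwo α) {s u : ℝ} (hs : 1 ≤ s) (hu : 0 ≤ u) :
    α (s * u) ≤ s ^ pAlpha α * α u := by
  rcases hu.eq_or_lt with rfl | hu
  · simp [hα.zero]
  set p := pAlpha α
  have key : α (s * u) * (s * u) ^ (-p) ≤ α u * u ^ (-p) := by
    have hle : u ≤ s * u := by nlinarith
    refine image_le_of_deriv_right_le_deriv_boundary (f := fun t => α t * t ^ (-p))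
      (f' := fun t => rightD α t * t ^ (-p) + α t * ((-p) * t ^ (-p - 1)))
      (B := fun _ => α u * u ^ (-p)) (B' := fun _ => 0) (a := u) (b := s * u)
      ?_ ?_ le_rfl continuousOn_const (fun x _ => hasDerivWithinAt_const _ _ _) ?_ ⟨hle, le_rfl⟩
    · refine hα.continuous.continuousOn.mul (ContinuousOn.rpow_const continuousOn_id ?_)
      intro x hx
      exact Or.inl (hu.trans_le hx.1).ne'
    · intro x hx
      have hx0 : 0 < x := hu.trans_le hx.1
      exact (hα.hasDerivWithinAt_rightD x).Ici_of_Ioi.mul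
        (Real.hasDerivAt_rpow_const (Or.inl hx0.ne')).hasDerivWithinAt
    · intro x hx
      have hx0 : 0 < x := hu.trans_le hx.1
      have h := hα.mul_rightD_le hΔ hx0
      have e : x ^ (-p) = x ^ (-p - 1) * x := by
        rw [← Real.rpow_add_one hx0.ne']; ring_nf
      have h2 : 0 ≤ x ^ (-p - 1) := Real.rpow_nonneg hx0.le _
      rw [e]
      have : rightD α x * (x ^ (-p - 1) * x) + α x * (-p * x ^ (-p - 1))
        = x ^ (-p - 1) * (x * rightD α x - p * α x) := by ring
      rw [this]
      exact mul_nonpos_of_nonneg_of_nonpos h2 (by linarith)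
  have hs0 : 0 < s := by linarith
  rw [Real.mul_rpow hs0.le hu.le, Real.rpow_neg hs0.le, Real.rpow_neg hu.le] at key
  have h1 : 0 < s ^ p := Real.rpow_pos_of_pos hs0 _
  have h2 : 0 < u ^ p := Real.rpow_pos_of_pos hu _
  have : α (s * u) * ((s ^ p)⁻¹ * (u ^ p)⁻¹) * (s ^ p * u ^ p) ≤ α u * (u ^ p)⁻¹ * (s ^ p * u ^ p) :=
    mul_le_mul_of_nonneg_right key (by positivity)
  field_simp at this
  linarith

lemma one_lt_pAlpha (hα : IsYoung α) (hΔ : DeltaTwo α) : 1 < pAlpha α := by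
  by_contra! hp
  have hle : ∀ u ∈ Ioo (0 : ℝ) 1, α 1 ≤ α u / u := by
    intro u hu
    have h1 : 1 ≤ u⁻¹ := (one_le_inv₀ hu.1).2 hu.2.le
    have h := hα.growth hΔ h1 hu.1.le
    rw [inv_mul_cancel₀ hu.1.ne'] at h
    refine h.trans ?_
    rw [div_eq_inv_mul]
    refine mul_le_mul_of_nonneg_right ?_ (hα.nonneg u)
    simpa using Real.rpow_le_rpow_of_exponent_le h1 hp
  have hlim : Tendsto (fun u => α u / u) (𝓝[>] 0) (𝓝 0) := by
    have h := hα.hasDerivWithinAt_rightD 0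
    rw [hα.rightD_zero, hasDerivWithinAt_iff_tendsto_slope' (by simp)] at h
    refine h.congr fun u => ?_
    simp [slope_def_field, hα.zero]
  have h0 : α 1 ≤ 0 := ge_of_tendsto hlim (by
    filter_upwards [Ioo_mem_nhdsGT (zero_lt_one' ℝ)] with u hu using hle u hu)
  exact absurd (hα.pos one_pos) h0.not_gt

lemma growth_add (hα : IsYoung α) (hΔ : DeltaTwo α) {s u r : ℝ} (hs : 0 < s) (hs1 : s < 1)
    (hu : 0 ≤ u) (hr : 0 ≤ r) :
    α (u + r) ≤ α u / (1 - s) + (pAlpha α / s) ^ (pAlpha α - 1) * α r := by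
  have hp := hα.one_lt_pAlpha hΔ
  set p := pAlpha α
  have hp0 : 0 < p := by linarith
  set θ := s / p with hθ
  have hθ0 : 0 < θ := by positivity
  have hθs : θ ≤ s := div_le_self hs.le hp.le
  have hθ1 : θ < 1 := hθs.trans_lt hs1
  have hη0 : 0 < 1 - θ := by linarith
  have hrpow : ∀ t : ℝ, 0 < t → t * (t⁻¹) ^ p = (t⁻¹) ^ (p - 1) := by
    intro t ht
    rw [Real.rpow_sub_one (by positivity)]
    field_simp
  have hconv := hα.convex.2 (mem_univ ((1 - θ)⁻¹ * u)) (mem_univ (θ⁻¹ * r)) hη0.le hθ0.le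
    (by ring)
  simp only [smul_eq_mul] at hconv
  rw [mul_inv_cancel_left₀ hη0.ne', mul_inv_cancel_left₀ hθ0.ne'] at hconv
  have h1 := hα.growth hΔ (s := (1 - θ)⁻¹) ((one_le_inv₀ hη0).2 (by linarith)) hu
  have h2 := hα.growth hΔ (s := θ⁻¹) ((one_le_inv₀ hθ0).2 hθ1.le) hr
  have h1' : (1 - θ) * α ((1 - θ)⁻¹ * u) ≤ ((1 - θ)⁻¹) ^ (p - 1) * α u := by
    rw [← hrpow _ hη0, mul_assoc]; gcongr
  have h2' : θ * α (θ⁻¹ * r) ≤ (θ⁻¹) ^ (p - 1) * α r := by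
    rw [← hrpow _ hθ0, mul_assoc]; gcongr
  have h3 : ((1 - θ)⁻¹) ^ (p - 1) ≤ (1 - s)⁻¹ := by
    rw [Real.inv_rpow hη0.le]
    refine inv_anti₀ (by linarith) ?_
    rcases le_total 1 (p - 1) with h | h
    · have := one_add_mul_self_le_rpow_one_add (s := -θ) (by linarith) h
      have e : (p - 1) * θ ≤ s := by
        rw [hθ, mul_div_assoc', div_le_iff₀ hp0]; nlinarith
      calc 1 - s ≤ 1 + (p - 1) * -θ := by linarith
        _ ≤ _ := this
        _ = _ := by ring_nf
    · calc 1 - s ≤ 1 - θ := by linarith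
        _ = (1 - θ) ^ (1 : ℝ) := by simp
        _ ≤ _ := Real.rpow_le_rpow_of_exponent_ge hη0 (by linarith) h
  have h4 : θ⁻¹ = p / s := by rw [hθ, inv_div]
  rw [h4] at h2' hconv
  have h5 := mul_le_mul_of_nonneg_right h3 (hα.nonneg u)
  rw [div_eq_inv_mul]
  linarith

lemma add_le_of_delta (hα : IsYoung α) {K : ℝ} (hK0 : 0 < K)
    (hK : ∀ x, α (2 * x) ≤ K * α x) {u r t : ℝ} (ht : 0 ≤ t)
    (htur : t ≤ u + r) : α t ≤ K * (α u + α r) := by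
  have h1 : α t ≤ α (2 * max u r) :=
    hα.le_of_le ht (by linarith [le_max_left u r, le_max_right u r])
  refine h1.trans ((hK _).trans ?_)
  gcongr
  rcases max_choice u r with h | h <;> rw [h] <;> linarith [hα.nonneg u, hα.nonneg r]

end IsYoung

section BoundedFun

variable {Y : Type*} {f g : Y → ℝ}

lemma IsBoundedFun.exp (hf : IsBoundedFun f) : IsBoundedFun fun x => Real.exp (f x) := by
  obtain ⟨M, hM⟩ := hf
  refine ⟨Real.exp M, fun x => ?_⟩
  rw [Real.abs_exp]
  exact Real.exp_le_exp.2 ((le_abs_self _).trans (hM x))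

lemma IsBoundedFun.const_mul (hf : IsBoundedFun f) (c : ℝ) : IsBoundedFun fun x => c * f x := by
  obtain ⟨M, hM⟩ := hf
  refine ⟨|c| * M, fun x => ?_⟩
  rw [abs_mul]
  exact mul_le_mul_of_nonneg_left (hM x) (abs_nonneg c)

lemma IsBoundedFun.sub (hf : IsBoundedFun f) (hg : IsBoundedFun g) :
    IsBoundedFun fun x => f x - g x := by
  obtain ⟨M, hM⟩ := hf
  obtain ⟨N, hN⟩ := hg
  exact ⟨M + N, fun x => (abs_sub _ _).trans (add_le_add (hM x) (hN x))⟩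

lemma IsBoundedFun.integrable [MeasurableSpace Y] {μ : Measure Y} [IsFiniteMeasure μ]
    (hf : IsBoundedFun f) (hm : Measurable f) : Integrable f μ := by
  obtain ⟨M, hM⟩ := hf
  exact Integrable.of_bound hm.aestronglyMeasurable M (ae_of_all _ hM)

end BoundedFun

section Entropy

variable {X : Type*} [MeasurableSpace X] {μ : Measure X} [IsProbabilityMeasure μ]

/-- Donsker–Varadhan inequality for a bounded function. -/
lemma integral_le_integral_llr_add_log {ν : Measure X} [IsProbabilityMeasure ν] (hν : ν ≪ μ)
    (hint : Integrable (llr ν μ) ν) {h : X → ℝ} (hm : Measurable h) (hb : IsBoundedFun h) :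
    ∫ x, h x ∂ν ≤ ∫ x, llr ν μ x ∂ν + Real.log (∫ x, Real.exp (h x) ∂μ) := by
  have hexp : Integrable (fun x => Real.exp (h x)) μ := hb.exp.integrable hm.exp
  have := isProbabilityMeasure_tilted hexp
  have h1 := integral_llr_tilted_right hν (hb.integrable hm) hexp hint
  have h2 := InformationTheory.integral_llr_add_sub_measure_univ_nonneg
    (hν.trans (absolutelyContinuous_tilted hexp))
    (integrable_llr_tilted_right hν (hb.integrable hm) hint hexp)
  simp at h2
  linarith

lemma integral_le_log_integral_exp {h : X → ℝ} (hm : Measurable h) (hb : IsBoundedFun h) :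
    ∫ x, h x ∂μ ≤ Real.log (∫ x, Real.exp (h x) ∂μ) := by
  have h1 := integral_le_integral_llr_add_log (μ := μ) (ν := μ) Measure.AbsolutelyContinuous.rfl
    ((integrable_zero X ℝ μ).congr (llr_self μ).symm) hm hb
  rwa [integral_congr_ae (llr_self μ), Pi.zero_def, integral_zero, zero_add] at h1

lemma llr_tilted_self_ae {h : X → ℝ} (hm : Measurable h) (hb : IsBoundedFun h) :
    llr (μ.tilted h) μ =ᵐ[μ.tilted h] fun x => h x - Real.log (∫ z, Real.exp (h z) ∂μ) :=
  (tilted_absolutelyContinuous μ h).ae_le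
    (log_rnDeriv_tilted_left_self (hb.exp.integrable hm.exp))

lemma integrable_llr_tilted_self {h : X → ℝ} (hm : Measurable h) (hb : IsBoundedFun h) :
    Integrable (llr (μ.tilted h) μ) (μ.tilted h) := by
  have := isProbabilityMeasure_tilted (hb.exp.integrable (μ := μ) hm.exp)
  exact ((hb.integrable hm).sub (integrable_const _)).congr (llr_tilted_self_ae hm hb).symm

lemma integral_llr_tilted_self {h : X → ℝ} (hm : Measurable h) (hb : IsBoundedFun h) :
    ∫ x, llr (μ.tilted h) μ x ∂(μ.tilted h)
      = ∫ x, h x ∂(μ.tilted h) - Real.log (∫ x, Real.exp (h x) ∂μ) := by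
  have := isProbabilityMeasure_tilted (hb.exp.integrable (μ := μ) hm.exp)
  rw [integral_congr_ae (llr_tilted_self_ae hm hb),
    integral_sub (hb.integrable hm) (integrable_const _)]
  simp

end Entropy

lemma relEnt_eq {X : Type*} [MeasurableSpace X] {ν μ : Measure X} (hν : ν ≪ μ)
    (hint : Integrable (llr ν μ) ν) :
    relEnt ν μ = ENNReal.ofReal (∫ x, llr ν μ x ∂ν) :=
  if_pos ⟨hν, hint⟩

section Transport

variable {X : Type*} [MetricSpace X] [MeasurableSpace X] {α : ℝ → ℝ}

/-- A transport-entropy inequality provides almost optimal couplings. -/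
lemma TransportEntropy.exists_coupling {μ ν : Measure X} [IsProbabilityMeasure ν]
    {C : ℝ} (hT : TransportEntropy μ α C) (hν : ν ≪ μ) (hint : Integrable (llr ν μ) ν)
    {ε : ℝ≥0∞} (hε : ε ≠ 0) :
    ∃ π : Measure (X × X), π.map Prod.fst = ν ∧ π.map Prod.snd = μ ∧
      ∫⁻ z, ENNReal.ofReal (α (dist z.1 z.2)) ∂π
        ≤ ENNReal.ofReal C * ENNReal.ofReal (∫ x, llr ν μ x ∂ν) + ε := by
  have h := hT ν inferInstance
  rw [relEnt_eq hν hint] at h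
  have hlt : transportCost α ν μ
      < ENNReal.ofReal C * ENNReal.ofReal (∫ x, llr ν μ x ∂ν) + ε :=
    h.trans_lt (ENNReal.lt_add_right (by finiteness) hε)
  obtain ⟨c, ⟨π, h1, h2, rfl⟩, hc⟩ := sInf_lt_iff.1 hlt
  exact ⟨π, h1, h2, hc.le⟩

lemma measurable_cost [BorelSpace X] [TopologicalSpace.SeparableSpace X] (hα : IsYoung α) :
    Measurable fun z : X × X => α (dist z.1 z.2) := by
  have := UniformSpace.secondCountable_of_separable X
  exact (hα.continuous.comp continuous_dist).measurable

/-- A transport-entropy inequality implies a modified log-Sobolev inequality in which the energy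
of `h` is any function `D` such that `h x - h y ≤ D x + lam * α (d x y)`. -/
lemma TransportEntropy.logSobolev [BorelSpace X] [TopologicalSpace.SeparableSpace X]
    (hα : IsYoung α) {μ : Measure X}
    [IsProbabilityMeasure μ] {C lam : ℝ} (hC : 0 < C) (hlam : 0 < lam)
    (hT : TransportEntropy μ α C) {h D : X → ℝ} (hm : Measurable h) (hb : IsBoundedFun h)
    (hDm : Measurable D) (hDb : IsBoundedFun D)
    (hD : ∀ x y, h x - h y ≤ D x + lam * α (dist x y)) :
    (1 - lam * C) * (∫ x, h x ∂(μ.tilted h) - Real.log (∫ x, Real.exp (h x) ∂μ))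
      ≤ ∫ x, D x ∂(μ.tilted h) := by
  have := isProbabilityMeasure_tilted (hb.exp.integrable (μ := μ) hm.exp)
  set H := ∫ x, h x ∂(μ.tilted h) - Real.log (∫ x, Real.exp (h x) ∂μ) with hH
  have hac := tilted_absolutelyContinuous μ h
  have hint := integrable_llr_tilted_self (μ := μ) hm hb
  have hHeq := integral_llr_tilted_self (μ := μ) hm hb
  have hH0 : 0 ≤ H := by
    have h2 := InformationTheory.integral_llr_add_sub_measure_univ_nonneg hac hint
    simp at h2
    linarith
  have hJ := integral_le_log_integral_exp (μ := μ) hm hb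
  suffices hε : ∀ ε > 0, H ≤ ∫ x, D x ∂(μ.tilted h) + lam * (C * H + ε) by
    have : H ≤ ∫ x, D x ∂(μ.tilted h) + lam * (C * H) := by
      refine le_of_forall_pos_le_add fun ε hε0 => ?_
      have := hε (ε / lam) (by positivity)
      rw [mul_add, mul_div_cancel₀ _ hlam.ne'] at this
      linarith
    linarith
  intro ε hε
  obtain ⟨π, h1, h2, hπ⟩ := hT.exists_coupling hac hint (ε := ENNReal.ofReal ε) (by simpa using hε)
  rw [hHeq, ← hH, ← ENNReal.ofReal_mul hC.le, ← ENNReal.ofReal_add (by positivity) hε.le] at hπ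
  have hπp : IsProbabilityMeasure π := by
    constructor
    rw [← Set.preimage_univ (f := Prod.snd), ← Measure.map_apply measurable_snd MeasurableSet.univ,
      h2, measure_univ]
  have hcm := measurable_cost (X := X) hα
  have hci : Integrable (fun z : X × X => α (dist z.1 z.2)) π := by
    refine ⟨hcm.aestronglyMeasurable, ?_⟩
    rw [hasFiniteIntegral_iff_ofReal (ae_of_all _ fun z => hα.nonneg _)]
    exact hπ.trans_lt ENNReal.ofReal_lt_top
  have hcost : ∫ z, α (dist z.1 z.2) ∂π ≤ C * H + ε := by
    rw [integral_eq_lintegral_of_nonneg_ae (ae_of_all _ fun z => hα.nonneg _)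
      hcm.aestronglyMeasurable]
    exact ENNReal.toReal_le_of_le_ofReal (by positivity) hπ
  have e1 : ∀ f : X → ℝ, Measurable f → ∫ x, f x ∂(μ.tilted h) = ∫ z, f z.1 ∂π := by
    intro f hf
    rw [← h1, integral_map measurable_fst.aemeasurable hf.aestronglyMeasurable]
  have e2 : ∫ x, h x ∂μ = ∫ z, h z.2 ∂π := by
    conv_lhs => rw [← h2]
    rw [integral_map measurable_snd.aemeasurable hm.aestronglyMeasurable]
  have i1 : ∀ f : X → ℝ, Measurable f → IsBoundedFun f →
      Integrable (fun z : X × X => f z.1) π := by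
    intro f hf ⟨M, hM⟩
    exact IsBoundedFun.integrable ⟨M, fun z => hM z.1⟩ (hf.comp measurable_fst)
  have i2 : Integrable (fun z : X × X => h z.2) π := by
    obtain ⟨M, hM⟩ := hb
    exact IsBoundedFun.integrable ⟨M, fun z => hM z.2⟩ (hm.comp measurable_snd)
  have hle : ∫ z, (h z.1 - h z.2) ∂π ≤ ∫ z, (D z.1 + lam * α (dist z.1 z.2)) ∂π :=
    integral_mono ((i1 h hm hb).sub i2) ((i1 D hDm hDb).add (hci.const_mul _))
      fun z => hD z.1 z.2
  rw [integral_sub (i1 h hm hb) i2, integral_add (i1 D hDm hDb) (hci.const_mul _),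
    integral_const_mul, ← e1 h hm, ← e1 D hDm, ← e2] at hle
  have := mul_le_mul_of_nonneg_left hcost hlam.le
  linarith

/-- Bounded perturbation of the modified log-Sobolev inequality. -/
lemma TransportEntropy.logSobolev_tilted [BorelSpace X] [TopologicalSpace.SeparableSpace X]
    (hα : IsYoung α) {μ : Measure X}
    [IsProbabilityMeasure μ] {C lam : ℝ} (hC : 0 < C) (hlam : 0 < lam) (hlamC : lam * C < 1)
    (hT : TransportEntropy μ α C) {φ : X → ℝ} (hφm : Measurable φ) (hφb : IsBoundedFun φ)
    {h D : X → ℝ} (hm : Measurable h) (hb : IsBoundedFun h)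
    (hDm : Measurable D) (hDb : IsBoundedFun D) (hD0 : ∀ x, 0 ≤ D x)
    (hD : ∀ x y, h x - h y ≤ D x + lam * α (dist x y)) :
    ∫ x, h x ∂((μ.tilted φ).tilted h) - Real.log (∫ x, Real.exp (h x) ∂(μ.tilted φ))
      ≤ Real.exp ((⨆ x, φ x) - ⨅ x, φ x) / (1 - lam * C) *
        ∫ x, D x ∂((μ.tilted φ).tilted h) := by
  have hlam1 : 0 < 1 - lam * C := by linarith
  have hbase := hT.logSobolev hα hC hlam hm hb hDm hDb hD
  have hφe : Integrable (fun x => Real.exp (φ x)) μ := hφb.exp.integrable hφm.exp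
  have := isProbabilityMeasure_tilted hφe
  set μ' := μ.tilted φ with hμ'
  have hbd : BddAbove (range φ) ∧ BddBelow (range φ) := by
    obtain ⟨M, hM⟩ := hφb
    exact ⟨⟨M, by rintro _ ⟨x, rfl⟩; exact (abs_le.1 (hM x)).2⟩,
      ⟨-M, by rintro _ ⟨x, rfl⟩; exact (abs_le.1 (hM x)).1⟩⟩
  set S := ⨆ x, φ x
  set I := ⨅ x, φ x
  have hS : ∀ x, φ x ≤ S := fun x => le_ciSup hbd.1 x
  have hI : ∀ x, I ≤ φ x := fun x => ciInf_le hbd.2 x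
  set Z := ∫ x, Real.exp (φ x) ∂μ with hZ
  have hZ0 : 0 < Z := integral_exp_pos hφe
  have hbe : Integrable (fun x => Real.exp (h x)) μ := hb.exp.integrable hm.exp
  have hbe' : Integrable (fun x => Real.exp (h x)) μ' := hb.exp.integrable hm.exp
  -- comparison of integrals of nonnegative functions
  have bmul : ∀ f : X → ℝ, IsBoundedFun f → IsBoundedFun fun x => Real.exp (φ x) / Z * f x := by
    rintro f ⟨M, hM⟩
    refine ⟨Real.exp S / Z * M, fun x => ?_⟩
    rw [abs_mul, abs_of_pos (by positivity)]
    gcongr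
    exacts [hS x, hM x]
  have up : ∀ f : X → ℝ, Measurable f → IsBoundedFun f → (∀ x, 0 ≤ f x) →
      ∫ x, f x ∂μ' ≤ Real.exp S / Z * ∫ x, f x ∂μ := by
    intro f hfm hfb hf0
    rw [hμ', integral_tilted, ← integral_const_mul]
    refine integral_mono ((bmul f hfb).integrable (by fun_prop))
      ((hfb.integrable hfm).const_mul _) fun x => ?_
    simp only [smul_eq_mul]
    have := hf0 x
    gcongr
    exact hS x
  have low : ∀ f : X → ℝ, Measurable f → IsBoundedFun f → (∀ x, 0 ≤ f x) →
      Real.exp I / Z * ∫ x, f x ∂μ ≤ ∫ x, f x ∂μ' := by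
    intro f hfm hfb hf0
    rw [hμ', integral_tilted, ← integral_const_mul]
    refine integral_mono ((hfb.integrable hfm).const_mul _)
      ((bmul f hfb).integrable (by fun_prop)) fun x => ?_
    simp only [smul_eq_mul]
    have := hf0 x
    gcongr
    exact hI x
  have tl : ∀ (m : Measure X) (f : X → ℝ),
      ∫ x, f x ∂(m.tilted h) = (∫ x, Real.exp (h x) * f x ∂m) / ∫ x, Real.exp (h x) ∂m := by
    intro m f
    rw [integral_tilted, ← integral_div]
    refine integral_congr_ae (ae_of_all _ fun x => ?_)
    simp only [smul_eq_mul]; ring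
  set E := ∫ x, Real.exp (h x) ∂μ
  set E' := ∫ x, Real.exp (h x) ∂μ'
  have hE0 : 0 < E := integral_exp_pos hbe
  have hE0' : 0 < E' := integral_exp_pos hbe'
  rw [tl, tl] at hbase ⊢
  -- the integrand of the variational formula for the entropy
  set c := Real.log E with hc
  have hcE : Real.exp c = E := Real.exp_log hE0
  set G : X → ℝ := fun x => Real.exp (h x) * h x - (c + 1) * Real.exp (h x) + E with hG
  have hehb : IsBoundedFun fun x => Real.exp (h x) * h x := by
    obtain ⟨M, hM⟩ := hb
    refine ⟨Real.exp M * M, fun x => ?_⟩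
    rw [abs_mul, Real.abs_exp]
    gcongr
    exacts [(le_abs_self _).trans (hM x), hM x]
  have heDb : IsBoundedFun fun x => Real.exp (h x) * D x := by
    obtain ⟨M, hM⟩ := hb
    obtain ⟨N, hN⟩ := hDb
    refine ⟨Real.exp M * N, fun x => ?_⟩
    rw [abs_mul, Real.abs_exp]
    gcongr
    exacts [(le_abs_self _).trans (hM x), hN x]
  have hehm : Measurable fun x => Real.exp (h x) * h x := by fun_prop
  have heDm : Measurable fun x => Real.exp (h x) * D x := by fun_prop
  have hGm : Measurable G := by fun_prop
  have hGb : IsBoundedFun G := by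
    obtain ⟨M, hM⟩ := hehb.sub (hb.exp.const_mul (c + 1))
    exact ⟨M + E, fun x => (abs_add_le _ _).trans (by
      rw [abs_of_pos hE0]; exact add_le_add_left (hM x) _)⟩
  have hG0 : ∀ x, 0 ≤ G x := by
    intro x
    have h1 := Real.add_one_le_exp (c - h x)
    have h2 : Real.exp (h x) * Real.exp (c - h x) = E := by
      rw [← Real.exp_add, ← hcE]; ring_nf
    have := mul_le_mul_of_nonneg_left h1 (Real.exp_pos (h x)).le
    simp only [hG]
    rw [← h2]
    linarith
  have hGint : ∀ (m : Measure X) [IsProbabilityMeasure m],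
      ∫ x, G x ∂m = ∫ x, Real.exp (h x) * h x ∂m - (c + 1) * ∫ x, Real.exp (h x) ∂m + E := by
    intro m _
    have i1 : Integrable (fun x => Real.exp (h x) * h x) m := hehb.integrable hehm
    have i2 : Integrable (fun x => (c + 1) * Real.exp (h x)) m :=
      (hb.exp.const_mul _).integrable (by fun_prop)
    have i3 : Integrable (fun x => Real.exp (h x) * h x - (c + 1) * Real.exp (h x)) m := i1.sub i2
    simp only [hG]
    rw [integral_add i3 (integrable_const _), integral_sub i1 i2, integral_const_mul]
    simp
  have hup := up G hGm hGb hG0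
  rw [hGint μ, hGint μ'] at hup
  have hlow := low _ heDm heDb fun x => mul_nonneg (Real.exp_pos _).le (hD0 x)
  change _ - Real.log E' ≤ _
  set P := ∫ x, Real.exp (h x) * h x ∂μ
  set P' := ∫ x, Real.exp (h x) * h x ∂μ'
  set Q := ∫ x, Real.exp (h x) * D x ∂μ
  set Q' := ∫ x, Real.exp (h x) * D x ∂μ'
  -- the entropy of the perturbed measure
  have hlog : E' * (c - Real.log E') ≤ E - E' := by
    have h1 := Real.log_le_sub_one_of_pos (div_pos hE0 hE0')
    rw [Real.log_div hE0.ne' hE0'.ne'] at h1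
    have := mul_le_mul_of_nonneg_left h1 hE0'.le
    rwa [mul_sub_one, mul_div_cancel₀ _ hE0'.ne'] at this
  have hent : (1 - lam * C) * (P - c * E) ≤ Q := by
    have := mul_le_mul_of_nonneg_right hbase hE0.le
    rw [div_mul_cancel₀ _ hE0.ne'] at this
    calc _ = (1 - lam * C) * (P / E - c) * E := by field_simp
      _ ≤ Q := this
  have hPc : P - c * E ≤ Q / (1 - lam * C) := by
    rw [le_div_iff₀ hlam1]; linarith
  have hQ : Q ≤ Z / Real.exp I * Q' := by
    have := mul_le_mul_of_nonneg_left hlow (a := Z / Real.exp I) (by positivity)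
    calc Q = Z / Real.exp I * (Real.exp I / Z * Q) := by field_simp
      _ ≤ _ := this
  have hfin : P' - Real.log E' * E' ≤ Real.exp (S - I) / (1 - lam * C) * Q' := by
    calc P' - Real.log E' * E' ≤ P' - (c + 1) * E' + E := by linarith
      _ ≤ Real.exp S / Z * (P - (c + 1) * E + E) := hup
      _ = Real.exp S / Z * (P - c * E) := by ring
      _ ≤ Real.exp S / Z * ((Z / Real.exp I * Q') / (1 - lam * C)) := by
        refine mul_le_mul_of_nonneg_left (hPc.trans ?_) (by positivity)
        gcongr
      _ = _ := by rw [Real.exp_sub]; field_simp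
  calc P' / E' - Real.log E' = (P' - Real.log E' * E') / E' := by field_simp
    _ ≤ (Real.exp (S - I) / (1 - lam * C) * Q') / E' := by gcongr
    _ = _ := by ring

end Transport

section SupConv

variable {X : Type*} [MetricSpace X] {α : ℝ → ℝ} {g : X → ℝ} {M : ℝ}

/-- The sup-convolution `x ↦ sup_y {g y - a α(d(x,y))}`. -/
noncomputable def supConv (α : ℝ → ℝ) (a : ℝ) (g : X → ℝ) (x : X) : ℝ :=
  ⨆ y : X, (g y - a * α (dist x y))

lemma bddAbove_supConv (hα : IsYoung α) (hM : ∀ x, |g x| ≤ M) {a : ℝ} (ha : 0 ≤ a) (x : X) :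
    BddAbove (range fun y => g y - a * α (dist x y)) := by
  refine ⟨M, ?_⟩
  rintro _ ⟨y, rfl⟩
  have := mul_nonneg ha (hα.nonneg (dist x y))
  simp only
  linarith [(abs_le.1 (hM y)).2]

lemma le_supConv (hα : IsYoung α) (hM : ∀ x, |g x| ≤ M) {a : ℝ} (ha : 0 ≤ a) (x y : X) :
    g y - a * α (dist x y) ≤ supConv α a g x :=
  le_ciSup (bddAbove_supConv hα hM ha x) y

lemma self_le_supConv (hα : IsYoung α) (hM : ∀ x, |g x| ≤ M) {a : ℝ} (ha : 0 ≤ a) (x : X) :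
    g x ≤ supConv α a g x := by
  simpa [hα.zero] using le_supConv hα hM ha x x

lemma supConv_le {a b : ℝ} {x : X} (h : ∀ y, g y - a * α (dist x y) ≤ b) :
    supConv α a g x ≤ b :=
  have : Nonempty X := ⟨x⟩
  ciSup_le h

lemma abs_supConv_le (hα : IsYoung α) (hM : ∀ x, |g x| ≤ M) {a : ℝ} (ha : 0 ≤ a) (x : X) :
    |supConv α a g x| ≤ M := by
  refine abs_le.2 ⟨(abs_le.1 (hM x)).1.trans (self_le_supConv hα hM ha x), supConv_le fun y => ?_⟩
  have := mul_nonneg ha (hα.nonneg (dist x y))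
  linarith [(abs_le.1 (hM y)).2]

lemma supConv_anti (hα : IsYoung α) (hM : ∀ x, |g x| ≤ M) {a b : ℝ} (ha : 0 ≤ a) (hab : a ≤ b)
    (x : X) : supConv α b g x ≤ supConv α a g x := by
  refine supConv_le fun y => le_trans ?_ (le_supConv hα hM ha x y)
  have := mul_le_mul_of_nonneg_right hab (hα.nonneg (dist x y))
  linarith

lemma measurable_supConv [MeasurableSpace X] [BorelSpace X] (hα : IsYoung α)
    (hM : ∀ x, |g x| ≤ M) {a : ℝ} (ha : 0 ≤ a) : Measurable (supConv α a g) := by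
  refine LowerSemicontinuous.measurable ?_
  refine lowerSemicontinuous_ciSup (fun x => bddAbove_supConv hα hM ha x) fun y => ?_
  have := hα.continuous
  exact Continuous.lowerSemicontinuous (by fun_prop)

lemma exists_supConv_lt {a : ℝ} (x : X) {ε : ℝ} (hε : 0 < ε) :
    ∃ z, supConv α a g x < g z - a * α (dist x z) + ε := by
  have : Nonempty X := ⟨x⟩
  obtain ⟨z, hz⟩ := exists_lt_of_lt_ciSup (f := fun y => g y - a * α (dist x y))
    (show supConv α a g x - ε < _ from sub_lt_self _ hε)
  exact ⟨z, by linarith⟩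

lemma supConv_sub_le (hα : IsYoung α) (hM : ∀ x, |g x| ≤ M) {a b : ℝ} (ha : 1 ≤ a) (hab : a ≤ b)
    (x : X) : supConv α a g x - supConv α b g x ≤ 2 * M * (b - a) := by
  refine le_of_forall_pos_le_add fun ε hε => ?_
  set δ := ε / (1 + (b - a)) with hδ
  have hba : 0 ≤ b - a := by linarith
  have hδ0 : 0 < δ := by positivity
  obtain ⟨z, hz⟩ := exists_supConv_lt (α := α) (g := g) (a := a) x hδ0
  have h1 := self_le_supConv hα hM (by linarith : 0 ≤ a) x
  have h2 := le_supConv hα hM (by linarith : 0 ≤ b) x z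
  have h3 : α (dist x z) ≤ 2 * M + δ := by
    have := mul_le_mul_of_nonneg_right ha (hα.nonneg (dist x z))
    linarith [(abs_le.1 (hM x)).1, (abs_le.1 (hM z)).2]
  have h4 := mul_le_mul_of_nonneg_left h3 hba
  have h5 : δ * (1 + (b - a)) = ε := div_mul_cancel₀ _ (by positivity)
  linarith

/-- The energy of a sup-convolution is controlled by its variation in the parameter. -/
lemma supConv_energy_le (hα : IsYoung α) (hΔ : DeltaTwo α) (hM : ∀ x, |g x| ≤ M)
    {a b k s lam : ℝ} (ha : 0 ≤ a) (hab : a < b) (hk : 0 ≤ k) (hs : 0 < s) (hs1 : s < 1)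
    (hlam : k * b * (pAlpha α / s) ^ (pAlpha α - 1) = lam) (x y : X) :
    k * supConv α b g x - k * supConv α b g y
      ≤ k * b * (s / (1 - s)) / (b - a) * (supConv α a g x - supConv α b g x)
        + lam * α (dist x y) := by
  have hs' : 0 < 1 - s := by linarith
  have hba : 0 < b - a := by linarith
  have hb : 0 < b := by linarith
  set R := k * b * (s / (1 - s)) / (b - a) with hR
  have hR0 : 0 ≤ R := by positivity
  refine le_of_forall_pos_le_add fun ε hε => ?_
  set δ := ε / (1 + k + R) with hδ
  have hδ0 : 0 < δ := by positivity
  have hδε : δ * (1 + k + R) = ε := div_mul_cancel₀ _ (by positivity)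
  obtain ⟨z, hz⟩ := exists_supConv_lt (α := α) (g := g) (a := b) x hδ0
  set u := dist x z
  set r := dist x y
  have h1 := le_supConv hα hM hb.le y z
  have h2 := le_supConv hα hM ha x z
  have h3 : α (dist y z) ≤ α (u + r) := hα.le_of_le dist_nonneg (by
    have := dist_triangle_left y z x; linarith)
  have h4 := hα.growth_add hΔ hs hs1 (u := u) (r := r) dist_nonneg dist_nonneg
  have h5 : k * b * α (u + r) - k * b * α u ≤ k * b * (s / (1 - s)) * α u + lam * α r := by
    have := mul_le_mul_of_nonneg_left h4 (by positivity : 0 ≤ k * b)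
    rw [mul_add, ← mul_assoc, hlam] at this
    have e : k * b * (α u / (1 - s)) = k * b * (s / (1 - s)) * α u + k * b * α u := by
      field_simp; ring
    linarith
  have h6 : k * b * (s / (1 - s)) * α u = R * ((b - a) * α u) := by
    rw [hR]; field_simp
  have h7 : (b - a) * α u ≤ supConv α a g x - supConv α b g x + δ := by linarith
  have h8 := mul_le_mul_of_nonneg_left h7 hR0
  have h9 : k * (supConv α b g x - supConv α b g y)
      ≤ k * (b * α (u + r) - b * α u + δ) := by
    have := mul_le_mul_of_nonneg_left h3 hb.le
    gcongr
    linarith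
  linarith

end SupConv

section Herbst

variable {X : Type*} [MetricSpace X] [MeasurableSpace X] {α : ℝ → ℝ}

/-- A modified log-Sobolev inequality in which the energy of `h` is any function `D ≥ 0` such that
`h x - h y ≤ D x + lam * α (d x y)`. -/
def ModLogSobolev (m : Measure X) (α : ℝ → ℝ) (lam A : ℝ) : Prop :=
  ∀ h D : X → ℝ, Measurable h → IsBoundedFun h → Measurable D → IsBoundedFun D → (∀ x, 0 ≤ D x) →
    (∀ x y, h x - h y ≤ D x + lam * α (dist x y)) →
    ∫ x, h x ∂(m.tilted h) - Real.log (∫ x, Real.exp (h x) ∂m) ≤ A * ∫ x, D x ∂(m.tilted h)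

/-- The free energy of the sup-convolution of `g`, at temperature `κ`. -/
noncomputable def freeEnergy (m : Measure X) (α : ℝ → ℝ) (g : X → ℝ) (a κ : ℝ) : ℝ :=
  κ * Real.log (∫ x, Real.exp (κ⁻¹ * supConv α a g x) ∂m)

variable [BorelSpace X] {m : Measure X} [IsProbabilityMeasure m]

lemma ModLogSobolev.freeEnergy_sub_le (hα : IsYoung α) (hΔ : DeltaTwo α) {lam A : ℝ}
    (hLS : ModLogSobolev m α lam A) {g : X → ℝ} {M : ℝ} (hM : ∀ x, |g x| ≤ M)
    {a b κ₀ κ₁ s N₀ N₁ : ℝ} (ha : 1 ≤ a) (hab : a < b) (hκ₁ : 0 < κ₁) (hκ : κ₁ ≤ κ₀)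
    (hs : 0 < s) (hs1 : s < 1)
    (hlam : κ₁⁻¹ * b * (pAlpha α / s) ^ (pAlpha α - 1) = lam)
    (hN₁ : N₁ = A * (κ₁⁻¹ * b * (s / (1 - s)))) (hN₀ : 0 < N₀) (hN : N₀ ≤ N₁)
    (hκN : N₀ * (κ₀ - κ₁) ≤ b - a) :
    freeEnergy m α g b κ₁ - freeEnergy m α g a κ₀ ≤ 2 * M / N₀ * ((b - a) * (N₁ - N₀)) := by
  have ha0 : 0 ≤ a := by linarith
  have hb0 : 0 ≤ b := by linarith
  have hba : 0 < b - a := by linarith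
  have hκ₀ : 0 < κ₀ := by linarith
  have hs' : 0 < 1 - s := by linarith
  set P := supConv α a g
  set Q := supConv α b g
  have hPm : Measurable P := measurable_supConv hα hM ha0
  have hQm : Measurable Q := measurable_supConv hα hM hb0
  have hPb : IsBoundedFun P := ⟨M, abs_supConv_le hα hM ha0⟩
  have hQb : IsBoundedFun Q := ⟨M, abs_supConv_le hα hM hb0⟩
  set h : X → ℝ := fun x => κ₁⁻¹ * Q x with hh
  have hm : Measurable h := by fun_prop
  have hb : IsBoundedFun h := hQb.const_mul _
  have := isProbabilityMeasure_tilted (hb.exp.integrable (μ := m) hm.exp)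
  set ν := m.tilted h
  set R := κ₁⁻¹ * b * (s / (1 - s)) / (b - a) with hR
  have hR0 : 0 ≤ R := by positivity
  set D : X → ℝ := fun x => R * (P x - Q x) with hD
  have hls := hLS h D hm hb (by fun_prop) ((hPb.sub hQb).const_mul _)
    (fun x => mul_nonneg hR0 (sub_nonneg.2 (supConv_anti hα hM ha0 hab.le x)))
    (supConv_energy_le hα hΔ hM ha0 hab (by positivity) hs hs1 hlam)
  have hdv := integral_le_integral_llr_add_log (tilted_absolutelyContinuous m h)
    (integrable_llr_tilted_self hm hb) (h := fun x => κ₀⁻¹ * P x) (by fun_prop) (hPb.const_mul _)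
  rw [integral_llr_tilted_self hm hb, integral_const_mul] at hdv
  change _ ≤ A * ∫ x, D x ∂ν at hls
  set H := ∫ x, h x ∂ν - Real.log (∫ x, Real.exp (h x) ∂m) with hH
  set J := ∫ x, (P x - Q x) ∂ν with hJ
  have hJeq : J = ∫ x, P x ∂ν - ∫ x, Q x ∂ν :=
    integral_sub (hPb.integrable hPm) (hQb.integrable hQm)
  have hJ0 : 0 ≤ J := integral_nonneg fun x => sub_nonneg.2 (supConv_anti hα hM ha0 hab.le x)
  have hJle : J ≤ 2 * M * (b - a) := by
    have := integral_mono (μ := ν) ((hPb.sub hQb).integrable (by fun_prop))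
      (integrable_const (2 * M * (b - a))) fun x => supConv_sub_le hα hM ha hab.le x
    simpa using this
  have hDint : ∫ x, D x ∂ν = R * J := integral_const_mul _ _
  have hhint : ∫ x, h x ∂ν = κ₁⁻¹ * ∫ x, Q x ∂ν := integral_const_mul _ _
  have hF₁ : freeEnergy m α g b κ₁ = ∫ x, Q x ∂ν - κ₁ * H := by
    rw [hH, hhint, mul_sub, mul_inv_cancel_left₀ hκ₁.ne']
    simp only [freeEnergy, sub_sub_cancel]
    rfl
  have hF₀ : ∫ x, P x ∂ν - κ₀ * H ≤ freeEnergy m α g a κ₀ := by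
    have := mul_le_mul_of_nonneg_left hdv hκ₀.le
    rw [mul_inv_cancel_left₀ hκ₀.ne', mul_add] at this
    have e : freeEnergy m α g a κ₀
      = κ₀ * Real.log (∫ x, Real.exp (κ₀⁻¹ * P x) ∂m) := rfl
    linarith
  have hHle : H ≤ N₁ / (b - a) * J := by
    rw [hDint] at hls
    refine hls.trans_eq ?_
    rw [hN₁, hR]; ring
  have hN₁0 : 0 ≤ N₁ := hN₀.le.trans hN
  have hκH : (κ₀ - κ₁) * H ≤ N₁ / N₀ * J := by
    have e : κ₀ - κ₁ ≤ (b - a) / N₀ := by rw [le_div_iff₀ hN₀]; linarith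
    calc (κ₀ - κ₁) * H ≤ (κ₀ - κ₁) * (N₁ / (b - a) * J) :=
          mul_le_mul_of_nonneg_left hHle (by linarith)
      _ ≤ (b - a) / N₀ * (N₁ / (b - a) * J) := by gcongr
      _ = _ := by field_simp
  calc freeEnergy m α g b κ₁ - freeEnergy m α g a κ₀ ≤ N₁ / N₀ * J - J := by
        rw [hF₁]; linarith
    _ = (N₁ - N₀) / N₀ * J := by field_simp
    _ ≤ (N₁ - N₀) / N₀ * (2 * M * (b - a)) :=
        mul_le_mul_of_nonneg_left hJle (div_nonneg (by linarith) hN₀.le)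
    _ = _ := by ring

/-- A function whose increments are dominated by the product of the increments of two
functions, one of them continuous, is nonincreasing. -/
lemma le_of_increment_le_mul {F a N : ℝ → ℝ} {c x y : ℝ} (hxy : x ≤ y)
    (hN : ContinuousOn N (Icc x y))
    (h : ∀ s t, x ≤ s → s ≤ t → t ≤ y → F t - F s ≤ c * ((a t - a s) * (N t - N s))) :
    F y ≤ F x := by
  have key : ∀ n : ℕ, ∀ s t, x ≤ s → s ≤ t → t ≤ y →
      F t - F s ≤ c / 2 ^ n * ((a t - a s) * (N t - N s)) := by
    intro n
    induction n with
    | zero => simpa using h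
    | succ n ih =>
      intro s t hs hst ht
      have hmem : (N s + N t) / 2 ∈ uIcc (N s) (N t) := by
        rcases le_total (N s) (N t) with hle | hle
        · rw [uIcc_of_le hle]; constructor <;> linarith
        · rw [uIcc_of_ge hle]; constructor <;> linarith
      obtain ⟨r, hr, hNr⟩ := intermediate_value_uIcc
        (hN.mono (by rw [uIcc_of_le hst]; exact Icc_subset_Icc hs ht)) hmem
      rw [uIcc_of_le hst] at hr
      have h1 := ih s r hs hr.1 (hr.2.trans ht)
      have h2 := ih r t (hs.trans hr.1) hr.2 ht
      rw [hNr] at h1 h2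
      have e : c / 2 ^ (n + 1) * ((a t - a s) * (N t - N s))
          = c / 2 ^ n * ((a r - a s) * ((N s + N t) / 2 - N s))
            + c / 2 ^ n * ((a t - a r) * (N t - (N s + N t) / 2)) := by
        rw [pow_succ]; field_simp; ring
      linarith
  have hlim : Tendsto (fun n : ℕ => c / 2 ^ n * ((a y - a x) * (N y - N x))) atTop (𝓝 0) := by
    have := (tendsto_inv_atTop_zero.comp
      (tendsto_pow_atTop_atTop_of_one_lt (one_lt_two (α := ℝ)))).const_mul c
    simpa [div_eq_mul_inv] using this.mul_const ((a y - a x) * (N y - N x))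
  have := ge_of_tendsto hlim (Eventually.of_forall fun n => key n x y le_rfl hxy le_rfl)
  linarith

end Herbst

section Path

variable {A p lam : ℝ}

/-- The cost multiplier along the path used in the Herbst argument. -/
noncomputable def pathMul (A p s : ℝ) : ℝ :=
  (1 + (A - 1) * s) ^ ((p - 1) * A / (A - 1))

/-- The temperature along the path used in the Herbst argument. -/
noncomputable def pathTemp (A p lam s : ℝ) : ℝ :=
  p ^ (p - 1) / lam * (s ^ (-(p - 1)) * pathMul A p s)

/-- The (negative) slope of the cost multiplier as a function of the temperature. -/
noncomputable def pathSlope (A p lam s : ℝ) : ℝ :=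
  A * (lam / p ^ (p - 1) * s ^ (p - 1) * (s / (1 - s)))

lemma one_le_pathMul (hA : 1 < A) (hp : 1 < p) {s : ℝ} (hs : 0 ≤ s) : 1 ≤ pathMul A p s := by
  have hB : 0 < A - 1 := by linarith
  have hq : 0 < p - 1 := by linarith
  exact Real.one_le_rpow (by nlinarith) (by positivity)

lemma hasDerivAt_pathMul (hA : 1 < A) {s : ℝ} (hs : 0 < s) :
    HasDerivAt (pathMul A p)
      ((p - 1) * A * (1 + (A - 1) * s) ^ ((p - 1) * A / (A - 1) - 1)) s := by
  have hB : 0 < A - 1 := by linarith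
  have h1 : HasDerivAt (fun s : ℝ => 1 + (A - 1) * s) (A - 1) s := by
    simpa using ((hasDerivAt_id s).const_mul (A - 1)).const_add 1
  have h2 := h1.rpow_const (p := (p - 1) * A / (A - 1)) (Or.inl (by positivity))
  refine h2.congr_deriv ?_
  rw [mul_div_cancel₀ _ hB.ne']

lemma hasDerivAt_pathTemp (hA : 1 < A) {s : ℝ} (hs : 0 < s) :
    HasDerivAt (pathTemp A p lam)
      (-(p ^ (p - 1) / lam * (s ^ (-(p - 1) - 1) * ((p - 1) *
        ((1 + (A - 1) * s) ^ ((p - 1) * A / (A - 1) - 1) * (1 - s)))))) s := by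
  have hB : 0 < A - 1 := by linarith
  have h0 : 0 < 1 + (A - 1) * s := by positivity
  have h := (((Real.hasDerivAt_rpow_const (p := -(p - 1)) (Or.inl hs.ne')).mul
    (hasDerivAt_pathMul (p := p) hA hs)).const_mul (p ^ (p - 1) / lam))
  refine h.congr_deriv ?_
  have e1 : s ^ (-(p - 1)) = s ^ (-(p - 1) - 1) * s := by
    rw [← Real.rpow_add_one hs.ne']; ring_nf
  have e2 : pathMul A p s
      = (1 + (A - 1) * s) ^ ((p - 1) * A / (A - 1) - 1) * (1 + (A - 1) * s) := by
    rw [← Real.rpow_add_one h0.ne', pathMul]; ring_nf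
  rw [e1, e2]
  ring

lemma pathSlope_pos (hA : 1 < A) (hp : 1 < p) (hlam : 0 < lam) {s : ℝ} (hs : 0 < s)
    (hs1 : s < 1) : 0 < pathSlope A p lam s := by
  have : 0 < 1 - s := by linarith
  have : 0 < p := by linarith
  have : 0 < A := by linarith
  unfold pathSlope
  positivity

lemma pathSlope_mono (hA : 1 < A) (hp : 1 < p) (hlam : 0 < lam) {s t : ℝ} (hs : 0 < s)
    (hst : s ≤ t) (ht : t < 1) : pathSlope A p lam s ≤ pathSlope A p lam t := by
  have : 0 < 1 - t := by linarith
  have : 0 < 1 - s := by linarith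
  have : 0 < p := by linarith
  have : 0 < A := by linarith
  have : 0 < p - 1 := by linarith
  have : 0 < t := by linarith
  unfold pathSlope
  gcongr

lemma pathMul_strictMono (hA : 1 < A) (hp : 1 < p) {s t : ℝ} (hs : 0 < s)
    (hst : s < t) : pathMul A p s < pathMul A p t := by
  have : 0 < A - 1 := by linarith
  have : 0 < p - 1 := by linarith
  unfold pathMul
  gcongr

lemma pathTemp_pos (hA : 1 < A) (hp : 1 < p) (hlam : 0 < lam) {s : ℝ} (hs : 0 < s) :
    0 < pathTemp A p lam s := by
  have h1 := one_le_pathMul hA hp hs.le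
  have : 0 < p := by linarith
  unfold pathTemp
  positivity

lemma pathTemp_anti (hA : 1 < A) (hp : 1 < p) (hlam : 0 < lam) {s t : ℝ} (hs : 0 < s)
    (hst : s ≤ t) (ht : t < 1) : pathTemp A p lam t ≤ pathTemp A p lam s := by
  have hd : ∀ x ∈ Icc s t, 0 < x := fun x hx => hs.trans_le hx.1
  refine antitoneOn_of_deriv_nonpos (convex_Icc s t)
    (fun x hx => (hasDerivAt_pathTemp hA (hd x hx)).continuousAt.continuousWithinAt)
    (fun x hx => (hasDerivAt_pathTemp hA (hd x (interior_subset hx))).differentiableAt.differentiableWithinAt)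
    ?_ ⟨le_rfl, hst⟩ ⟨hst, le_rfl⟩ hst
  intro x hx
  have hx0 := hd x (interior_subset hx)
  have hx1 : 0 < 1 - x := by have := (interior_subset hx).2; linarith
  have : 0 < p := by linarith
  have : 0 < p - 1 := by linarith
  have : 0 < A - 1 := by linarith
  rw [(hasDerivAt_pathTemp hA hx0).deriv, neg_nonpos]
  positivity

lemma pathSlope_mul_sub_le (hA : 1 < A) (hp : 1 < p) (hlam : 0 < lam) {s t : ℝ} (hs : 0 < s)
    (hst : s ≤ t) (ht : t < 1) :
    pathSlope A p lam s * (pathTemp A p lam s - pathTemp A p lam t)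
      ≤ pathMul A p t - pathMul A p s := by
  have hd : ∀ x ∈ Icc s t, 0 < x := fun x hx => hs.trans_le hx.1
  have hder : ∀ x ∈ Icc s t, HasDerivAt
      (fun x => pathSlope A p lam s * pathTemp A p lam x + pathMul A p x) _ x := fun x hx =>
    ((hasDerivAt_pathTemp (p := p) (lam := lam) hA (hd x hx)).const_mul _).add
      (hasDerivAt_pathMul hA (hd x hx))
  have hmono : MonotoneOn (fun x => pathSlope A p lam s * pathTemp A p lam x + pathMul A p x)
      (Icc s t) := by
    refine monotoneOn_of_deriv_nonneg (convex_Icc s t)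
      (fun x hx => (hder x hx).continuousAt.continuousWithinAt)
      (fun x hx => (hder x (interior_subset hx)).differentiableAt.differentiableWithinAt) ?_
    intro x hx
    have hx0 := hd x (interior_subset hx)
    have hxm := interior_subset hx
    have hx1 : 0 < 1 - x := by have := hxm.2; linarith
    have hp0 : 0 < p := by linarith
    have hp1 : 0 < p - 1 := by linarith
    have hB : 0 < A - 1 := by linarith
    rw [(hder x hxm).deriv]
    set W := (1 + (A - 1) * x) ^ ((p - 1) * A / (A - 1) - 1) with hW
    have hW0 : 0 < W := by positivity
    have hle := pathSlope_mono hA hp hlam hs hxm.1 (hxm.2.trans_lt ht)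
    have hpos : 0 ≤ p ^ (p - 1) / lam * (x ^ (-(p - 1) - 1) * ((p - 1) * (W * (1 - x)))) := by
      positivity
    have heq : pathSlope A p lam x * (p ^ (p - 1) / lam *
        (x ^ (-(p - 1) - 1) * ((p - 1) * (W * (1 - x))))) = (p - 1) * A * W := by
      have e : x ^ (p - 1) * x * x ^ (-(p - 1) - 1) = 1 := by
        rw [← Real.rpow_add_one hx0.ne', ← Real.rpow_add hx0]
        ring_nf; simp
      have hpp : p ^ (p - 1) ≠ 0 := (Real.rpow_pos_of_pos hp0 _).ne'
      calc _ = (x ^ (p - 1) * x * x ^ (-(p - 1) - 1)) * ((p - 1) * A * W) := by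
            unfold pathSlope; field_simp
        _ = _ := by rw [e, one_mul]
    have := mul_le_mul_of_nonneg_right hle hpos
    linarith
  have := hmono ⟨le_rfl, hst⟩ ⟨hst, le_rfl⟩ hst
  simp only at this
  linarith

lemma continuousOn_pathSlope {s t : ℝ} (hs : 0 < s) (ht : t < 1) :
    ContinuousOn (pathSlope A p lam) (Icc s t) := by
  intro x hx
  have hx0 : x ≠ 0 := (hs.trans_le hx.1).ne'
  have hx1 : 1 - x ≠ 0 := by have := hx.2; intro h; linarith
  unfold pathSlope
  refine ContinuousAt.continuousWithinAt ?_
  have : ContinuousAt (fun x : ℝ => x ^ (p - 1)) x :=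
    Real.continuousAt_rpow_const _ _ (Or.inl hx0)
  fun_prop (disch := assumption)

lemma tendsto_pathTemp_zero (hA : 1 < A) (hp : 1 < p) (hlam : 0 < lam) :
    Tendsto (pathTemp A p lam) (𝓝[>] 0) atTop := by
  have hp0 : 0 < p := by linarith
  have h1 : Tendsto (fun s : ℝ => p ^ (p - 1) / lam * s ^ (-(p - 1))) (𝓝[>] 0) atTop :=
    (tendsto_rpow_neg_nhdsGT_zero (by linarith)).const_mul_atTop (by positivity)
  refine tendsto_atTop_mono' _ ?_ h1
  filter_upwards [self_mem_nhdsWithin] with s (hs : 0 < s)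
  have := one_le_pathMul hA hp hs.le
  unfold pathTemp
  gcongr
  exact le_mul_of_one_le_right (by positivity) this

/-- The end point of the path. -/
lemma pathTemp_one_le (hp : 1 < p) (hlam : 0 < lam) {K : ℝ} (hK : 1 ≤ K)
    (hAK : A = K * (p / (p - 1))) :
    pathTemp A p lam 1 ≤ p ^ (p * p) / (p - 1) ^ (p * (p - 1)) * (lam * p)⁻¹ * K ^ (p - 1) := by
  have hp0 : 0 < p := by linarith
  have hq : 0 < p - 1 := by linarith
  have hK0 : 0 < K := by linarith
  have hA₀ : 1 < p / (p - 1) := by rw [lt_div_iff₀ hq]; linarith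
  have hA₀A : p / (p - 1) ≤ A := by rw [hAK]; nlinarith
  have hA : 1 < A := by linarith
  have hB : 0 < A - 1 := by linarith
  have hA0 : 0 < A := by linarith
  have hB₀ : p / (p - 1) - 1 = 1 / (p - 1) := by field_simp; ring
  have hbern : A ^ (1 / (A - 1)) ≤ (p / (p - 1)) ^ (p - 1) := by
    have h1 : 1 ≤ (p - 1) * (A - 1) := by
      have : 1 / (p - 1) ≤ A - 1 := by linarith
      rwa [div_le_iff₀ hq, mul_comm] at this
    have h2 := one_add_mul_self_le_rpow_one_add (s := 1 / (p - 1))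
      (by have : 0 < 1 / (p - 1) := by positivity
          linarith) h1
    have e : 1 + (p - 1) * (A - 1) * (1 / (p - 1)) = A := by field_simp; ring
    have e' : 1 + 1 / (p - 1) = p / (p - 1) := by field_simp; ring
    rw [e, e'] at h2
    calc A ^ (1 / (A - 1)) ≤ ((p / (p - 1)) ^ ((p - 1) * (A - 1))) ^ (1 / (A - 1)) := by gcongr
      _ = _ := by
        rw [← Real.rpow_mul (by positivity)]
        congr 1; field_simp
  have hmul : pathMul A p 1 = A ^ (p - 1) * (A ^ (1 / (A - 1))) ^ (p - 1) := by
    unfold pathMul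
    rw [← Real.rpow_mul hA0.le, ← Real.rpow_add hA0]
    congr 1
    · ring
    · field_simp; ring
  have hstep : pathMul A p 1
      ≤ (K * (p / (p - 1))) ^ (p - 1) * ((p / (p - 1)) ^ (p - 1)) ^ (p - 1) := by
    rw [hmul, hAK.symm]
    gcongr
  have hpq : 0 < p / (p - 1) := by positivity
  have hfin : p ^ (p - 1) / lam *
      ((K * (p / (p - 1))) ^ (p - 1) * ((p / (p - 1)) ^ (p - 1)) ^ (p - 1))
      = p ^ (p * p) / (p - 1) ^ (p * (p - 1)) * (lam * p)⁻¹ * K ^ (p - 1) := by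
    rw [Real.mul_rpow hK0.le hpq.le, ← Real.rpow_mul hpq.le, mul_assoc (K ^ (p - 1)),
      ← Real.rpow_add hpq, show p - 1 + (p - 1) * (p - 1) = p * (p - 1) by ring,
      Real.div_rpow hp0.le hq.le]
    have e : p ^ (p * p) = p ^ (p - 1) * p ^ (p * (p - 1)) * p := by
      rw [← Real.rpow_add hp0, ← Real.rpow_add_one hp0.ne']
      congr 1; ring
    rw [e]
    have := (Real.rpow_pos_of_pos hq (p * (p - 1))).ne'
    field_simp
  rw [← hfin]
  unfold pathTemp
  rw [Real.one_rpow, one_mul]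
  gcongr

end Path

section LogIntegralExp

variable {X : Type*} [MeasurableSpace X] {m : Measure X} [IsProbabilityMeasure m]

lemma mul_log_integral_exp_le {f : X → ℝ} (hf : Measurable f) {M κ : ℝ} (hM : ∀ x, |f x| ≤ M)
    (hκ : 0 < κ) (hMκ : M ≤ κ) :
    κ * Real.log (∫ x, Real.exp (κ⁻¹ * f x) ∂m) ≤ ∫ x, f x ∂m + M ^ 2 / κ := by
  have hfb : IsBoundedFun f := ⟨M, hM⟩
  have hexp : Integrable (fun x => Real.exp (κ⁻¹ * f x)) m :=
    (hfb.const_mul _).exp.integrable (by fun_prop)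
  have hpt : ∀ x, Real.exp (κ⁻¹ * f x) ≤ κ⁻¹ * f x + (1 + M ^ 2 / κ ^ 2) := by
    intro x
    have hx : |κ⁻¹ * f x| ≤ M / κ := by
      rw [abs_mul, abs_of_pos (inv_pos.2 hκ), div_eq_inv_mul]
      exact mul_le_mul_of_nonneg_left (hM x) (inv_pos.2 hκ).le
    have h1 := Real.abs_exp_sub_one_sub_id_le (hx.trans ((div_le_one hκ).2 hMκ))
    have h2 : (κ⁻¹ * f x) ^ 2 ≤ (M / κ) ^ 2 := by
      rw [← sq_abs]; gcongr
    rw [div_pow] at h2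
    linarith [(abs_le.1 h1).2]
  have hint : ∫ x, Real.exp (κ⁻¹ * f x) ∂m ≤ κ⁻¹ * ∫ x, f x ∂m + (1 + M ^ 2 / κ ^ 2) := by
    have := integral_mono (μ := m) hexp
      (((hfb.integrable hf).const_mul κ⁻¹).add (integrable_const (1 + M ^ 2 / κ ^ 2))) hpt
    simp only [Pi.add_apply] at this
    rwa [integral_add ((hfb.integrable hf).const_mul κ⁻¹) (integrable_const _),
      integral_const_mul, integral_const, probReal_univ, one_smul] at this
  have hlog := Real.log_le_sub_one_of_pos (integral_exp_pos hexp)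
  calc _ ≤ κ * (κ⁻¹ * ∫ x, f x ∂m + M ^ 2 / κ ^ 2) := by gcongr; linarith
    _ = _ := by field_simp

end LogIntegralExp

section Herbst

variable {X : Type*} [MetricSpace X] [MeasurableSpace X] [BorelSpace X] {α : ℝ → ℝ}
  {m : Measure X} [IsProbabilityMeasure m]

lemma ModLogSobolev.freeEnergy_path_le (hα : IsYoung α) (hΔ : DeltaTwo α) {lam A : ℝ}
    (hA : 1 < A) (hlam : 0 < lam) (hLS : ModLogSobolev m α lam A) {g : X → ℝ} {M : ℝ}
    (hM : ∀ x, |g x| ≤ M) {s t : ℝ} (hs : 0 < s) (hst : s ≤ t) (ht : t < 1) :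
    freeEnergy m α g (pathMul A (pAlpha α) t) (pathTemp A (pAlpha α) lam t)
      ≤ freeEnergy m α g (pathMul A (pAlpha α) s) (pathTemp A (pAlpha α) lam s) := by
  have hp := hα.one_lt_pAlpha hΔ
  set p := pAlpha α with hpdef
  have hp0 : 0 < p := by linarith
  have hM0 : 0 ≤ M := by
    obtain ⟨x⟩ : Nonempty X := nonempty_of_isProbabilityMeasure m
    exact (abs_nonneg _).trans (hM x)
  have hNs := pathSlope_pos hA hp hlam hs (hst.trans_lt ht)
  refine le_of_increment_le_mul
    (F := fun r => freeEnergy m α g (pathMul A p r) (pathTemp A p lam r))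
    (a := pathMul A p) (N := pathSlope A p lam) (c := 2 * M / pathSlope A p lam s) hst
    (continuousOn_pathSlope hs ht) fun r u hsr hru hut => ?_
  rcases hru.eq_or_lt with rfl | hru'
  · simp
  have hr : 0 < r := hs.trans_le hsr
  have hu : 0 < u := hr.trans hru'
  have hu1 : u < 1 := hut.trans_lt ht
  have hNr := pathSlope_mono hA hp hlam hs hsr (hru'.trans hu1)
  have hmul := one_le_pathMul hA hp hu.le
  have hmul0 : pathMul A p u ≠ 0 := by linarith
  have hw : (pathTemp A p lam u)⁻¹ * pathMul A p u = lam / p ^ (p - 1) * u ^ (p - 1) := by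
    have h1 := (Real.rpow_pos_of_pos hp0 (p - 1)).ne'
    have h2 := (Real.rpow_pos_of_pos hu (p - 1)).ne'
    unfold pathTemp
    rw [Real.rpow_neg hu.le]
    field_simp
  have hstep := hLS.freeEnergy_sub_le hα hΔ hM (a := pathMul A p r) (b := pathMul A p u)
    (κ₀ := pathTemp A p lam r) (κ₁ := pathTemp A p lam u) (s := u)
    (N₀ := pathSlope A p lam r) (N₁ := pathSlope A p lam u)
    (one_le_pathMul hA hp hr.le) (pathMul_strictMono hA hp hr hru')
    (pathTemp_pos hA hp hlam hu) (pathTemp_anti hA hp hlam hr hru hu1) hu hu1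
    (by
      rw [hw, ← hpdef, Real.div_rpow hp0.le hu.le]
      have h1 := (Real.rpow_pos_of_pos hp0 (p - 1)).ne'
      have h2 := (Real.rpow_pos_of_pos hu (p - 1)).ne'
      field_simp)
    (by rw [hw]; rfl) (pathSlope_pos hA hp hlam hr (hru'.trans hu1))
    (pathSlope_mono hA hp hlam hr hru hu1) (pathSlope_mul_sub_le hA hp hlam hr hru hu1)
  refine hstep.trans ?_
  have h1 := (pathMul_strictMono hA hp hr hru').le
  have h2 := pathSlope_mono hA hp hlam hr hru hu1
  refine mul_le_mul_of_nonneg_right ?_ (mul_nonneg (by linarith) (by linarith))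
  gcongr

/-- A modified log-Sobolev inequality implies a transport-entropy inequality in dual form. -/
lemma ModLogSobolev.dual_le (hα : IsYoung α) (hΔ : DeltaTwo α) {lam A : ℝ}
    (hA : 1 < A) (hlam : 0 < lam) (hLS : ModLogSobolev m α lam A)
    {ν : Measure X} [IsProbabilityMeasure ν] (hν : ν ≪ m) (hint : Integrable (llr ν m) ν)
    {g : X → ℝ} (hg : Measurable g) (hgb : IsBoundedFun g) :
    ∫ x, g x ∂ν - ∫ x, supConv α 1 g x ∂m
      ≤ pathTemp A (pAlpha α) lam 1 * ∫ x, llr ν m x ∂ν := by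
  have hp := hα.one_lt_pAlpha hΔ
  set p := pAlpha α with hpdef
  obtain ⟨M, hM⟩ := hgb
  have hfree : ∀ t ∈ Ioo (0 : ℝ) 1, freeEnergy m α g (pathMul A p t) (pathTemp A p lam t)
      ≤ ∫ x, supConv α 1 g x ∂m := by
    intro t ht
    have hlim : Tendsto (fun s => ∫ x, supConv α 1 g x ∂m + M ^ 2 / pathTemp A p lam s)
        (𝓝[>] 0) (𝓝 (∫ x, supConv α 1 g x ∂m)) := by
      simpa using ((tendsto_pathTemp_zero hA hp hlam).const_div_atTop (M ^ 2)).const_add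
        (∫ x, supConv α 1 g x ∂m)
    refine ge_of_tendsto hlim ?_
    filter_upwards [Ioo_mem_nhdsGT ht.1,
      (tendsto_pathTemp_zero hA hp hlam).eventually_ge_atTop M] with s hs hsM
    refine (hLS.freeEnergy_path_le hα hΔ hA hlam hM hs.1 hs.2.le ht.2).trans ?_
    have hκ := pathTemp_pos hA hp hlam hs.1
    have hmul := one_le_pathMul hA hp hs.1.le
    refine le_trans ?_ (mul_log_integral_exp_le (measurable_supConv hα hM zero_le_one)
      (abs_supConv_le hα hM zero_le_one) hκ hsM)
    have hm1 := measurable_supConv hα hM zero_le_one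
    have hm2 := measurable_supConv hα hM (zero_le_one.trans hmul)
    have hb1 : IsBoundedFun (supConv α 1 g) := ⟨M, abs_supConv_le hα hM zero_le_one⟩
    have hb2 : IsBoundedFun (supConv α (pathMul A p s) g) :=
      ⟨M, abs_supConv_le hα hM (zero_le_one.trans hmul)⟩
    have hi1 := (hb1.const_mul (pathTemp A p lam s)⁻¹).exp.integrable (μ := m) (by fun_prop)
    have hi2 := (hb2.const_mul (pathTemp A p lam s)⁻¹).exp.integrable (μ := m) (by fun_prop)
    refine mul_le_mul_of_nonneg_left (Real.log_le_log (integral_exp_pos hi2)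
      (integral_mono hi2 hi1 fun x => Real.exp_le_exp.2 ?_)) hκ.le
    exact mul_le_mul_of_nonneg_left (supConv_anti hα hM zero_le_one hmul x) (inv_pos.2 hκ).le
  have hbound : ∀ t ∈ Ioo (0 : ℝ) 1, ∫ x, g x ∂ν - ∫ x, supConv α 1 g x ∂m
      ≤ pathTemp A p lam t * ∫ x, llr ν m x ∂ν := by
    intro t ht
    have hκ := pathTemp_pos hA hp hlam ht.1
    have hmul := one_le_pathMul hA hp ht.1.le
    have ha0 := zero_le_one.trans hmul
    have hm := measurable_supConv hα hM ha0
    have hb : IsBoundedFun (supConv α (pathMul A p t) g) := ⟨M, abs_supConv_le hα hM ha0⟩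
    have hdv := integral_le_integral_llr_add_log hν hint
      (h := fun x => (pathTemp A p lam t)⁻¹ * supConv α (pathMul A p t) g x)
      (by fun_prop) (hb.const_mul _)
    rw [integral_const_mul] at hdv
    have h1 := mul_le_mul_of_nonneg_left hdv hκ.le
    rw [mul_inv_cancel_left₀ hκ.ne', mul_add] at h1
    have h2 : ∫ x, g x ∂ν ≤ ∫ x, supConv α (pathMul A p t) g x ∂ν :=
      integral_mono (IsBoundedFun.integrable ⟨M, hM⟩ hg) (hb.integrable hm)
        (self_le_supConv hα hM ha0)
    have h3 := hfree t ht
    unfold freeEnergy at h3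
    linarith
  have hlim : Tendsto (fun t => pathTemp A p lam t * ∫ x, llr ν m x ∂ν) (𝓝[<] 1)
      (𝓝 (pathTemp A p lam 1 * ∫ x, llr ν m x ∂ν)) :=
    (((hasDerivAt_pathTemp hA one_pos).continuousAt.tendsto).mono_left
      nhdsWithin_le_nhds).mul_const _
  refine ge_of_tendsto hlim ?_
  filter_upwards [Ioo_mem_nhdsLT (zero_lt_one' ℝ)] with t ht using hbound t ht

end Herbst

section FiniteDuality

/-- Duality for the finite optimal transport problem. -/
lemma exists_finite_coupling {ι : Type*} [Fintype ι] [Nonempty ι] {p q : ι → ℝ}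
    (hp : p ∈ stdSimplex ℝ ι) (hq : q ∈ stdSimplex ℝ ι) {c : ι → ι → ℝ} {V : ℝ}
    (hV : ∀ f M : ι → ℝ, (∀ i j, f i - c i j ≤ M j) → ∑ i, f i * p i - ∑ j, M j * q j ≤ V) :
    ∃ w : ι → ι → ℝ, (∀ i j, 0 ≤ w i j) ∧ (∀ i, ∑ j, w i j = p i) ∧ (∀ j, ∑ i, w i j = q j) ∧
      ∑ i, ∑ j, w i j * c i j ≤ V := by
  classical
  let S : Set (ι → ι → ℝ) := Set.univ.pi fun _ => stdSimplex ℝ ι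
  have hS : IsCompact S := isCompact_univ_pi fun _ => isCompact_stdSimplex ℝ ι
  have hSc : Convex ℝ S := convex_pi fun _ _ => convex_stdSimplex ℝ ι
  let Φ : (ι → ι → ℝ) →ₗ[ℝ] (ι → ℝ) × ℝ :=
    { toFun := fun σ => (fun i => ∑ j, q j * σ j i, ∑ i, ∑ j, q j * σ j i * c i j)
      map_add' := fun σ τ => by
        ext <;> simp [mul_add, add_mul, Finset.sum_add_distrib]
      map_smul' := fun r σ => by
        ext
        · simp only [Pi.smul_apply, smul_eq_mul, RingHom.id_apply, Prod.smul_mk, Finset.mul_sum]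
          exact Finset.sum_congr rfl fun j _ => by ring
        · simp only [Pi.smul_apply, smul_eq_mul, RingHom.id_apply, Prod.smul_mk, Finset.mul_sum]
          exact Finset.sum_congr rfl fun j _ => Finset.sum_congr rfl fun i _ => by ring }
  have hΦ : Continuous Φ := Φ.continuous_of_finiteDimensional
  let W : Set ((ι → ℝ) × ℝ) := {p} ×ˢ Iic V
  by_cases hdis : Disjoint (Φ '' S) W
  · exfalso
    obtain ⟨F, u, v, hFu, huv, hFv⟩ := geometric_hahn_banach_compact_closed
      (hSc.linear_image Φ) (hS.image hΦ) ((convex_singleton p).prod (convex_Iic V))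
      (isClosed_singleton.prod isClosed_Iic) hdis
    set ρ : ℝ := F (0, 1) with hρ
    set l : ι → ℝ := fun i => F (Pi.single i 1, 0) with hl
    have hF : ∀ z r, F (z, r) = ∑ i, z i * l i + r * ρ := by
      intro z r
      have e1 : (z, r) = (z, (0 : ℝ)) + r • ((0 : ι → ℝ), (1 : ℝ)) := by simp
      have e2 : (z, (0 : ℝ)) = ∑ i, z i • ((Pi.single i 1 : ι → ℝ), (0 : ℝ)) := by
        ext k
        · simp [Prod.fst_sum, Finset.sum_apply, Pi.single_apply]
        · simp [Prod.snd_sum]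
      rw [e1, map_add, map_smul, e2, map_sum]
      simp only [map_smul, smul_eq_mul, hl, hρ]
    have hlt : ∀ σ ∈ S, ∀ t ≤ V, ∑ i, (∑ j, q j * σ j i) * l i
        + (∑ i, ∑ j, q j * σ j i * c i j) * ρ < ∑ i, p i * l i + t * ρ := by
      intro σ hσ t ht
      have h1 := hFu (Φ σ) ⟨σ, hσ, rfl⟩
      have h2 := hFv (p, t) ⟨rfl, ht⟩
      rw [show Φ σ = (fun i => ∑ j, q j * σ j i, ∑ i, ∑ j, q j * σ j i * c i j) from rfl, hF] at h1
      rw [hF] at h2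
      linarith
    have hpS : (fun _ => p) ∈ S := fun _ _ => hp
    have hρneg : ρ < 0 := by
      set a := ∑ i, ∑ j, q j * p i * c i j
      have h := hlt _ hpS (min V (a - 1)) (min_le_left _ _)
      have e : ∀ i, ∑ j, q j * p i = p i := fun i => by rw [← Finset.sum_mul, hq.2, one_mul]
      simp only [e] at h
      have h3 : min V (a - 1) ≤ a - 1 := min_le_right _ _
      by_contra hcon
      push Not at hcon
      nlinarith
    have hmax : ∀ j, ∃ i₀, ∀ i, l i / (-ρ) - c i j ≤ l i₀ / (-ρ) - c i₀ j := fun j =>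
      Finite.exists_max fun i => l i / (-ρ) - c i j
    choose k hk using hmax
    have hσ : (fun j => Pi.single (k j) 1) ∈ S := fun j _ => single_mem_stdSimplex ℝ (k j)
    have h := hlt _ hσ V le_rfl
    have h' := hV (fun i => l i / (-ρ)) (fun j => l (k j) / (-ρ) - c (k j) j) fun i j => hk j i
    have e1 : ∑ i, (∑ j, q j * (Pi.single (k j) 1 : ι → ℝ) i) * l i = ∑ j, q j * l (k j) := by
      simp only [Finset.sum_mul]
      rw [Finset.sum_comm]
      simp [Pi.single_apply]
    have e2 : ∑ i, ∑ j, q j * (Pi.single (k j) 1 : ι → ℝ) i * c i j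
        = ∑ j, q j * c (k j) j := by
      rw [Finset.sum_comm]
      simp [Pi.single_apply]
    rw [e1, e2] at h
    have e3 : ∑ i, l i / (-ρ) * p i = (∑ i, p i * l i) / (-ρ) := by
      rw [Finset.sum_div]; exact Finset.sum_congr rfl fun i _ => by ring
    have e4 : ∑ j, (l (k j) / (-ρ) - c (k j) j) * q j
        = (∑ j, q j * l (k j)) / (-ρ) - ∑ j, q j * c (k j) j := by
      rw [Finset.sum_div, ← Finset.sum_sub_distrib]
      exact Finset.sum_congr rfl fun i _ => by ring
    rw [e3, e4] at h'
    have h'' : (∑ i, p i * l i - ∑ j, q j * l (k j)) / (-ρ) ≤ V - ∑ j, q j * c (k j) j := by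
      rw [sub_div]; linarith
    rw [div_le_iff₀ (by linarith)] at h''
    linarith
  · obtain ⟨_, ⟨σ, hσ, rfl⟩, hW1, hW2⟩ := Set.not_disjoint_iff.1 hdis
    refine ⟨fun i j => q j * σ j i, fun i j => mul_nonneg (hq.1 j) ((hσ j trivial).1 i),
      fun i => congrFun hW1 i, fun j => ?_, hW2⟩
    rw [← Finset.mul_sum, (hσ j trivial).2, mul_one]

end FiniteDuality

section Glue

variable {X ι : Type*} [MeasurableSpace X] [Fintype ι] [MeasurableSpace ι]
  [MeasurableSingletonClass ι]

/-- A coupling of the images of two measures under a finite-valued map lifts to a coupling of the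
measures themselves. -/
lemma exists_coupling_of_finite {ν m : Measure X} [IsProbabilityMeasure ν]
    [IsProbabilityMeasure m] {T : X → ι} (hT : Measurable T) {w : ι → ι → ℝ≥0∞}
    (hw₁ : ∀ i, ∑ j, w i j = ν (T ⁻¹' {i})) (hw₂ : ∀ j, ∑ i, w i j = m (T ⁻¹' {j})) :
    ∃ π : Measure (X × X), π.map Prod.fst = ν ∧ π.map Prod.snd = m ∧
      ∀ F : ι → ι → ℝ≥0∞, ∫⁻ z, F (T z.1) (T z.2) ∂π ≤ ∑ i, ∑ j, w i j * F i j := by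
  classical
  have hTm : ∀ i, MeasurableSet (T ⁻¹' {i}) := fun i => hT (measurableSet_singleton i)
  have hle₁ : ∀ i j, w i j ≤ ν (T ⁻¹' {i}) := fun i j => by
    rw [← hw₁]; exact Finset.single_le_sum (f := fun j => w i j) (by simp) (Finset.mem_univ j)
  have hle₂ : ∀ i j, w i j ≤ m (T ⁻¹' {j}) := fun i j => by
    rw [← hw₂]; exact Finset.single_le_sum (f := fun i => w i j) (by simp) (Finset.mem_univ i)
  have hdiv : ∀ {a b : ℝ≥0∞}, a ≤ b → b ≠ ∞ → a / b * b = a := fun {a b} hab hb =>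
    ENNReal.div_mul_cancel' (fun h => by simpa [h] using hab) (fun h => absurd h hb)
  have hsum : ∀ (ρ : Measure X) (s : Set X), MeasurableSet s →
      ∑ i, ρ (s ∩ T ⁻¹' {i}) = ρ s := by
    intro ρ s hs
    rw [← measure_biUnion_finset (fun i _ j _ hij => ?_) fun i _ => hs.inter (hTm i)]
    · congr 1; ext x; simp
    · refine Set.disjoint_left.2 fun x hx hx' => hij ?_
      exact hx.2.symm.trans hx'.2
  have hcell : ∀ (ρ : Measure X) [IsProbabilityMeasure ρ] (s : Set X) (i : ι) (a b : ι → ℝ≥0∞),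
      (∑ j, a j = ρ (T ⁻¹' {i})) → (∀ j, a j ≤ b j) → (∀ j, b j ≠ ∞) →
      ∑ j, a j / ρ (T ⁻¹' {i}) / b j * (ρ (s ∩ T ⁻¹' {i}) * b j) = ρ (s ∩ T ⁻¹' {i}) := by
    intro ρ _ s i a b ha hab hb
    have hj : ∀ j, a j / ρ (T ⁻¹' {i}) / b j * (ρ (s ∩ T ⁻¹' {i}) * b j)
        = a j * (ρ (s ∩ T ⁻¹' {i}) / ρ (T ⁻¹' {i})) := fun j =>
      calc _ = a j / b j * b j * (ρ (s ∩ T ⁻¹' {i}) / ρ (T ⁻¹' {i})) := by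
            simp only [div_eq_mul_inv]; ring
        _ = _ := by rw [hdiv (hab j) (hb j)]
    rw [Finset.sum_congr rfl fun j _ => hj j, ← Finset.sum_mul, ha, mul_comm]
    exact hdiv (measure_mono inter_subset_right) (measure_ne_top ρ _)
  let π : Measure (X × X) := ∑ i, ∑ j, (w i j / ν (T ⁻¹' {i}) / m (T ⁻¹' {j})) •
    (ν.restrict (T ⁻¹' {i})).prod (m.restrict (T ⁻¹' {j}))
  refine ⟨π, ?_, ?_, fun F => ?_⟩
  · ext s hs
    rw [Measure.map_apply measurable_fst hs, ← Set.prod_univ, ← hsum ν s hs]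
    simp only [π, Measure.finsetSum_apply, Measure.smul_apply, Measure.prod_prod,
      Measure.restrict_apply hs, Measure.restrict_apply_univ, smul_eq_mul]
    exact Finset.sum_congr rfl fun i _ =>
      hcell ν s i _ _ (hw₁ i) (fun j => hle₂ i j) fun j => measure_ne_top m _
  · ext s hs
    rw [Measure.map_apply measurable_snd hs, ← Set.univ_prod, ← hsum m s hs]
    simp only [π, Measure.finsetSum_apply, Measure.smul_apply, Measure.prod_prod,
      Measure.restrict_apply hs, Measure.restrict_apply_univ, smul_eq_mul]
    rw [Finset.sum_comm]
    refine Finset.sum_congr rfl fun j _ => ?_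
    refine (Finset.sum_congr rfl fun i _ => ?_).trans
      (hcell m s j _ _ (hw₂ j) (fun i => hle₁ i j) fun i => measure_ne_top ν _)
    simp only [div_eq_mul_inv]
    ring
  · simp only [π, lintegral_finsetSum_measure, lintegral_smul_measure, smul_eq_mul]
    refine Finset.sum_le_sum fun i _ => Finset.sum_le_sum fun j _ => ?_
    rw [Measure.prod_restrict, setLIntegral_congr_fun ((hTm i).prod (hTm j))
      (g := fun _ => F i j) fun z hz => by
        rw [show T z.1 = i from hz.1, show T z.2 = j from hz.2],
      setLIntegral_const, Measure.prod_prod]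
    calc _ = w i j / ν (T ⁻¹' {i}) * ν (T ⁻¹' {i}) / m (T ⁻¹' {j}) * m (T ⁻¹' {j}) * F i j := by
          simp only [div_eq_mul_inv]; ring
      _ ≤ _ := by
          rw [hdiv (hle₁ i j) (measure_ne_top ν _), hdiv (hle₂ i j) (measure_ne_top m _)]

end Glue

section Modulus

variable {X : Type*} [MetricSpace X] {α : ℝ → ℝ}

/-- On bounded sets, the cost varies little under small displacements of both points. -/
lemma IsYoung.exists_modulus (hα : IsYoung α) (x₀ : X) (R : ℝ) {ε : ℝ} (hε : 0 < ε) :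
    ∃ δ > 0, ∀ x y x' y' : X, x ∈ Metric.closedBall x₀ R → y ∈ Metric.closedBall x₀ R →
      x' ∈ Metric.closedBall x₀ R → y' ∈ Metric.closedBall x₀ R → dist x x' < δ → dist y y' < δ →
      α (dist x y) ≤ α (dist x' y') + ε := by
  have hu := isCompact_Icc.uniformContinuousOn_of_continuous
    (hα.continuous.continuousOn (s := Icc 0 (2 * R)))
  obtain ⟨δ, hδ, h⟩ := Metric.uniformContinuousOn_iff.1 hu ε hε
  have hmem : ∀ x y : X, x ∈ Metric.closedBall x₀ R → y ∈ Metric.closedBall x₀ R →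
      dist x y ∈ Icc 0 (2 * R) := by
    intro x y hx hy
    rw [Metric.mem_closedBall] at hx hy
    have := dist_triangle_right x y x₀
    exact ⟨dist_nonneg, by linarith⟩
  refine ⟨δ / 2, half_pos hδ, fun x y x' y' hx hy hx' hy' h1 h2 => ?_⟩
  have hd : dist (dist x y) (dist x' y') < δ := by
    have := dist_dist_dist_le x y x' y'
    linarith
  have := h _ (hmem x y hx hy) _ (hmem x' y' hx' hy') hd
  rw [Real.dist_eq] at this
  linarith [(abs_lt.1 this).2]

end Modulus

section Duality

variable {X : Type*} [MetricSpace X] [MeasurableSpace X] [BorelSpace X] {α : ℝ → ℝ}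

/-- A compact set splits into finitely many measurable cells of small diameter. -/
lemma IsCompact.exists_measurable_cells {B : Set X} (hB : IsCompact B) {δ : ℝ} (hδ : 0 < δ) :
    ∃ (n : ℕ) (T : X → Fin n), Measurable T ∧
      ∀ x y, T x = T y → x ∈ B → y ∈ B ∧ dist x y < δ := by
  classical
  obtain ⟨t, -, htf, hcov⟩ := hB.finite_cover_balls (half_pos hδ)
  have := htf.fintype
  let T₀ : X → (t → Prop) × Prop := fun x => (fun i => x ∈ Metric.ball (i : X) (δ / 2), x ∈ B)
  have hT₀ : Measurable T₀ := by
    refine Measurable.prodMk (measurable_pi_iff.2 fun i => ?_) ?_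
    · exact measurableSet_setOfPred.1 Metric.isOpen_ball.measurableSet
    · exact measurableSet_setOfPred.1 hB.measurableSet
  refine ⟨_, Fintype.equivFin _ ∘ T₀, (measurable_of_finite _).comp hT₀, fun x y hxy hx => ?_⟩
  have h : T₀ x = T₀ y := (Fintype.equivFin _).injective hxy
  refine ⟨(congrArg Prod.snd h).mp hx, ?_⟩
  obtain ⟨i, hi, hxi⟩ := mem_iUnion₂.1 (hcov hx)
  have hyi : y ∈ Metric.ball i (δ / 2) := (congrFun (congrArg Prod.fst h) ⟨i, hi⟩).mp hxi
  have := dist_triangle_right x y i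
  rw [Metric.mem_ball] at hxi hyi
  linarith

lemma measurable_cost_left (hα : IsYoung α) (x₀ : X) : Measurable fun x => α (dist x x₀) :=
  (hα.continuous.comp (continuous_id.dist continuous_const)).measurable

/-- The tails of a convergent cost integral vanish. -/
lemma exists_tail_lt (hα : IsYoung α) {ρ : Measure X} (x₀ : X)
    (hρ : ∫⁻ x, ENNReal.ofReal (α (dist x x₀)) ∂ρ ≠ ∞) {ε : ℝ≥0∞} (hε : ε ≠ 0) :
    ∀ᶠ n : ℕ in atTop,
      ∫⁻ x in (Metric.closedBall x₀ n)ᶜ, ENNReal.ofReal (α (dist x x₀)) ∂ρ < ε := by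
  have hm := (measurable_cost_left hα x₀).ennreal_ofReal
  have hlim : Tendsto (fun n : ℕ => ∫⁻ x, (Metric.closedBall x₀ n)ᶜ.indicator
      (fun x => ENNReal.ofReal (α (dist x x₀))) x ∂ρ) atTop (𝓝 (∫⁻ _, 0 ∂ρ)) := by
    refine tendsto_lintegral_of_dominated_convergence _
      (fun n => hm.indicator Metric.isClosed_closedBall.measurableSet.compl)
      (fun n => Eventually.of_forall fun x => indicator_le_self _ _ x) hρ
      (Eventually.of_forall fun x => tendsto_const_nhds.congr' ?_)
    filter_upwards [eventually_ge_atTop ⌈dist x x₀⌉₊] with n hn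
    rw [indicator_of_notMem]
    simpa using (Nat.le_ceil _).trans (Nat.cast_le.2 hn)
  rw [lintegral_zero] at hlim
  filter_upwards [hlim.eventually_lt_const (pos_iff_ne_zero.2 hε)] with n hn
  rwa [lintegral_indicator Metric.isClosed_closedBall.measurableSet.compl] at hn

lemma integral_comp_finite {ι : Type*} [Fintype ι] [MeasurableSpace ι] [MeasurableSingletonClass ι]
    {Y : Type*} [MeasurableSpace Y] {ρ : Measure Y} [IsFiniteMeasure ρ] {T : Y → ι}
    (hT : Measurable T) (f : ι → ℝ) : ∫ x, f (T x) ∂ρ = ∑ i, f i * ρ.real (T ⁻¹' {i}) := by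
  rw [← integral_map hT.aemeasurable (measurable_of_finite f).aestronglyMeasurable,
    integral_fintype Integrable.of_finite]
  refine Finset.sum_congr rfl fun i _ => ?_
  rw [map_measureReal_apply hT (measurableSet_singleton i), smul_eq_mul, mul_comm]

lemma sum_measureReal_fibers {ι : Type*} [Fintype ι] [MeasurableSpace ι]
    [MeasurableSingletonClass ι] {Y : Type*} [MeasurableSpace Y] {ρ : Measure Y}
    [IsProbabilityMeasure ρ] {T : Y → ι} (hT : Measurable T) :
    (fun i => ρ.real (T ⁻¹' {i})) ∈ stdSimplex ℝ ι := by
  refine ⟨fun i => measureReal_nonneg, ?_⟩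
  have := integral_comp_finite (ρ := ρ) hT fun _ => 1
  simpa using this.symm

/-- A bound on the Kantorovich dual functional over bounded measurable functions bounds the
transport cost. -/
lemma transportCost_le_of_dual [ProperSpace X] (hα : IsYoung α) (hΔ : DeltaTwo α)
    {ν m : Measure X} [IsProbabilityMeasure ν] [IsProbabilityMeasure m] (x₀ : X)
    (hν : ∫⁻ x, ENNReal.ofReal (α (dist x x₀)) ∂ν ≠ ∞)
    (hm : ∫⁻ x, ENNReal.ofReal (α (dist x x₀)) ∂m ≠ ∞) {V : ℝ}
    (hV : ∀ g : X → ℝ, Measurable g → IsBoundedFun g →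
      ∫ x, g x ∂ν - ∫ x, supConv α 1 g x ∂m ≤ V) :
    transportCost α ν m ≤ ENNReal.ofReal V := by
  obtain ⟨K, hK0, hK⟩ := hΔ
  refine ENNReal.le_of_forall_pos_le_add fun ε hε _ => ?_
  set ψ : X → ℝ≥0∞ := fun x => ENNReal.ofReal (α (dist x x₀)) with hψ
  have hψm : Measurable ψ := (measurable_cost_left hα x₀).ennreal_ofReal
  have hε2 : (0 : ℝ) < ε / 2 := by positivity
  obtain ⟨τ, hτ0, hτ⟩ : ∃ τ : ℝ, 0 < τ ∧ 2 * K * (τ + τ) = ε / 2 :=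
    ⟨ε / 2 / (4 * K), by positivity, by field_simp; ring⟩
  have hτ' : ENNReal.ofReal τ ≠ 0 := by simpa using hτ0
  obtain ⟨n, hnν, hnm⟩ :=
    ((exists_tail_lt hα x₀ hν hτ').and (exists_tail_lt hα x₀ hm hτ')).exists
  set B := Metric.closedBall x₀ (n : ℝ) with hB
  have hBm : MeasurableSet Bᶜ := Metric.isClosed_closedBall.measurableSet.compl
  obtain ⟨δ, hδ, hmod⟩ := hα.exists_modulus x₀ n hε2
  obtain ⟨N, T, hT, hcell⟩ := (isCompact_closedBall x₀ (n : ℝ)).exists_measurable_cells hδ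
  have : Nonempty (Fin N) := ⟨T x₀⟩
  let c : Fin N → Fin N → ℝ := fun i j => sInf {r | ∃ x y, T x = i ∧ T y = j ∧ r = α (dist x y)}
  have hc_le : ∀ x y, c (T x) (T y) ≤ α (dist x y) := fun x y =>
    csInf_le ⟨0, by rintro _ ⟨x, y, -, -, rfl⟩; exact hα.nonneg _⟩ ⟨x, y, rfl, rfl, rfl⟩
  have hc0 : ∀ i j, 0 ≤ c i j := fun i j =>
    Real.sInf_nonneg (by rintro _ ⟨x, y, -, -, rfl⟩; exact hα.nonneg _)
  have hc_ge : ∀ x ∈ B, ∀ y ∈ B, α (dist x y) ≤ c (T x) (T y) + ε / 2 := by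
    intro x hx y hy
    rw [← sub_le_iff_le_add]
    refine le_csInf ⟨_, x, y, rfl, rfl, rfl⟩ ?_
    rintro _ ⟨x', y', hx', hy', rfl⟩
    have h1 := hcell x x' hx'.symm hx
    have h2 := hcell y y' hy'.symm hy
    linarith [hmod x y x' y' hx hy h1.1 h2.1 h1.2 h2.2]
  obtain ⟨w, hw0, hw1, hw2, hwV⟩ := exists_finite_coupling (p := fun i => ν.real (T ⁻¹' {i}))
    (q := fun i => m.real (T ⁻¹' {i})) (c := c) (V := V)
    (sum_measureReal_fibers hT) (sum_measureReal_fibers hT) fun f M hfM => by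
      have hfb : IsBoundedFun fun x => f (T x) := by
        obtain ⟨b, hb⟩ := (Set.finite_range fun i => |f i|).bddAbove
        exact ⟨b, fun x => hb ⟨T x, rfl⟩⟩
      have hMb : IsBoundedFun fun x => M (T x) := by
        obtain ⟨b, hb⟩ := (Set.finite_range fun i => |M i|).bddAbove
        exact ⟨b, fun x => hb ⟨T x, rfl⟩⟩
      have hfm : Measurable fun x => f (T x) := (measurable_of_finite f).comp hT
      have h := hV _ hfm hfb
      have h2 : ∫ x, supConv α 1 (fun x => f (T x)) x ∂m ≤ ∫ x, M (T x) ∂m := by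
        obtain ⟨b, hb⟩ := id hfb
        refine integral_mono (IsBoundedFun.integrable ⟨b, abs_supConv_le hα hb zero_le_one⟩
          (measurable_supConv hα hb zero_le_one))
          (hMb.integrable ((measurable_of_finite M).comp hT)) fun x => supConv_le fun y => ?_
        rw [one_mul, dist_comm]
        linarith [hfM (T y) (T x), hc_le y x]
      rw [integral_comp_finite hT] at h h2
      linarith
  obtain ⟨π, hπ1, hπ2, hπ⟩ := exists_coupling_of_finite (ν := ν) (m := m) hT
    (w := fun i j => ENNReal.ofReal (w i j))
    (fun i => by
      rw [← ENNReal.ofReal_sum_of_nonneg fun j _ => hw0 i j, hw1, ofReal_measureReal])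
    (fun j => by
      rw [← ENNReal.ofReal_sum_of_nonneg fun i _ => hw0 i j, hw2, ofReal_measureReal])
  have hπp : IsProbabilityMeasure π := by
    refine ⟨?_⟩
    rw [← measure_univ (μ := ν), ← hπ1, Measure.map_apply measurable_fst MeasurableSet.univ,
      preimage_univ]
  unfold transportCost
  refine sInf_le_of_le ⟨π, hπ1, hπ2, rfl⟩ ?_
  have hK2 : ∀ x y, α (dist x y) ≤ K * (α (dist x x₀) + α (dist y x₀)) := fun x y =>
    hα.add_le_of_delta hK0 hK dist_nonneg (dist_triangle_right x y x₀)
  have hsplit : ∀ x y, ENNReal.ofReal (α (dist x y)) ≤ ENNReal.ofReal (c (T x) (T y))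
      + ENNReal.ofReal (ε / 2)
      + ENNReal.ofReal (2 * K) * (Bᶜ.indicator ψ x + Bᶜ.indicator ψ y) := by
    intro x y
    have hα0 : ∀ x, 0 ≤ α (dist x x₀) := fun x => hα.nonneg _
    have hout : ∀ x ∉ B, ∀ y ∈ B, α (dist y x₀) ≤ α (dist x x₀) := fun x hx y hy => by
      rw [hB, Metric.mem_closedBall] at hx hy
      exact hα.le_of_le dist_nonneg (by linarith)
    by_cases hx : x ∈ B
    · by_cases hy : y ∈ B
      · refine le_add_right ?_
        rw [← ENNReal.ofReal_add (hc0 _ _) hε2.le]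
        exact ENNReal.ofReal_le_ofReal (hc_ge x hx y hy)
      · refine le_add_left ?_
        rw [indicator_of_notMem (by simpa using hx), indicator_of_mem (by simpa using hy), zero_add,
          ← ENNReal.ofReal_mul (by positivity)]
        refine ENNReal.ofReal_le_ofReal ((hK2 x y).trans ?_)
        nlinarith [hout y hy x hx]
    · refine le_add_left ?_
      rw [indicator_of_mem (by simpa using hx)]
      by_cases hy : y ∈ B
      · rw [indicator_of_notMem (by simpa using hy), add_zero, ← ENNReal.ofReal_mul (by positivity)]
        refine ENNReal.ofReal_le_ofReal ((hK2 x y).trans ?_)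
        nlinarith [hout x hx y hy]
      · rw [indicator_of_mem (by simpa using hy), ← ENNReal.ofReal_add (hα0 x) (hα0 y),
          ← ENNReal.ofReal_mul (by positivity)]
        refine ENNReal.ofReal_le_ofReal ((hK2 x y).trans ?_)
        nlinarith [hα0 x, hα0 y]
  have hcost : ∑ i, ∑ j, ENNReal.ofReal (w i j) * ENNReal.ofReal (c i j) ≤ ENNReal.ofReal V := by
    refine le_trans (le_of_eq ?_) (ENNReal.ofReal_le_ofReal hwV)
    rw [ENNReal.ofReal_sum_of_nonneg fun i _ =>
      Finset.sum_nonneg fun j _ => mul_nonneg (hw0 i j) (hc0 i j)]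
    refine Finset.sum_congr rfl fun i _ => ?_
    rw [ENNReal.ofReal_sum_of_nonneg fun j _ => mul_nonneg (hw0 i j) (hc0 i j)]
    exact Finset.sum_congr rfl fun j _ => (ENNReal.ofReal_mul (hw0 i j)).symm
  have hψi : Measurable (Bᶜ.indicator ψ) := hψm.indicator hBm
  have h1 : ∫⁻ z, Bᶜ.indicator ψ z.1 ∂π ≤ ENNReal.ofReal τ := by
    rw [← lintegral_map hψi measurable_fst, hπ1, lintegral_indicator hBm]
    exact hnν.le
  have h2 : ∫⁻ z, Bᶜ.indicator ψ z.2 ∂π ≤ ENNReal.ofReal τ := by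
    rw [← lintegral_map hψi measurable_snd, hπ2, lintegral_indicator hBm]
    exact hnm.le
  calc ∫⁻ z, ENNReal.ofReal (α (dist z.1 z.2)) ∂π
      ≤ ∫⁻ z, (ENNReal.ofReal (c (T z.1) (T z.2)) + ENNReal.ofReal (ε / 2)
        + ENNReal.ofReal (2 * K) * (Bᶜ.indicator ψ z.1 + Bᶜ.indicator ψ z.2)) ∂π :=
        lintegral_mono fun z => hsplit z.1 z.2
    _ = ∫⁻ z, ENNReal.ofReal (c (T z.1) (T z.2)) ∂π + ENNReal.ofReal (ε / 2)
        + ENNReal.ofReal (2 * K) *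
          (∫⁻ z, Bᶜ.indicator ψ z.1 ∂π + ∫⁻ z, Bᶜ.indicator ψ z.2 ∂π) := by
        rw [lintegral_add_right _ (by fun_prop), lintegral_add_right _ (by fun_prop),
          lintegral_const, measure_univ, mul_one, lintegral_const_mul _ (by fun_prop),
          lintegral_add_right _ (by fun_prop)]
    _ ≤ ENNReal.ofReal V + ENNReal.ofReal (ε / 2)
        + ENNReal.ofReal (2 * K) * (ENNReal.ofReal τ + ENNReal.ofReal τ) := by
        gcongr
        exact (hπ fun i j => ENNReal.ofReal (c i j)).trans hcost
    _ = ENNReal.ofReal V + ε := by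
        rw [← ENNReal.ofReal_add hτ0.le hτ0.le, ← ENNReal.ofReal_mul (by positivity), hτ, add_assoc,
          ← ENNReal.ofReal_add hε2.le hε2.le, add_halves, ENNReal.ofReal_coe_nnreal]

end Duality

section Moments

variable {X : Type*} [MetricSpace X] [MeasurableSpace X] [BorelSpace X] {α : ℝ → ℝ}

lemma lintegral_cost_ne_top_of_dist (hα : IsYoung α) (hΔ : DeltaTwo α) {Ω : Type*}
    [MeasurableSpace Ω] {π : Measure Ω} {f g : Ω → X} (hg : Measurable g) (x₀ : X)
    (hfg : ∫⁻ z, ENNReal.ofReal (α (dist (f z) (g z))) ∂π ≠ ∞)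
    (hgx : ∫⁻ z, ENNReal.ofReal (α (dist (g z) x₀)) ∂π ≠ ∞) :
    ∫⁻ z, ENNReal.ofReal (α (dist (f z) x₀)) ∂π ≠ ∞ := by
  obtain ⟨K, hK0, hK⟩ := hΔ
  have hgm : Measurable fun z => ENNReal.ofReal (α (dist (g z) x₀)) :=
    ((measurable_cost_left hα x₀).comp hg).ennreal_ofReal
  refine ne_top_of_le_ne_top (b := ENNReal.ofReal K *
    (∫⁻ z, ENNReal.ofReal (α (dist (f z) (g z))) ∂π
      + ∫⁻ z, ENNReal.ofReal (α (dist (g z) x₀)) ∂π)) (by finiteness) ?_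
  rw [← lintegral_add_right _ hgm, ← lintegral_const_mul' _ _ ENNReal.ofReal_ne_top]
  refine lintegral_mono fun z => ?_
  rw [← ENNReal.ofReal_add (hα.nonneg _) (hα.nonneg _), ← ENNReal.ofReal_mul hK0.le]
  exact ENNReal.ofReal_le_ofReal
    (hα.add_le_of_delta hK0 hK dist_nonneg (dist_triangle _ _ _))

/-- A measure satisfying a transport-entropy inequality has a finite cost moment. -/
lemma TransportEntropy.lintegral_cost_ne_top (hα : IsYoung α) (hΔ : DeltaTwo α) {μ : Measure X}
    [IsProbabilityMeasure μ] {C : ℝ} (hT : TransportEntropy μ α C) (x₀ : X) :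
    ∫⁻ x, ENNReal.ofReal (α (dist x x₀)) ∂μ ≠ ∞ := by
  set ψ : X → ℝ := fun x => α (dist x x₀)
  have hψ : Measurable ψ := measurable_cost_left hα x₀
  have hψ0 : ∀ x, 0 ≤ ψ x := fun x => hα.nonneg _
  have hexp : Integrable (fun x => Real.exp (-ψ x)) μ := by
    refine IsBoundedFun.integrable ⟨1, fun x => ?_⟩ (by fun_prop)
    rw [abs_of_pos (Real.exp_pos _), Real.exp_le_one_iff]
    linarith [hψ0 x]
  have := isProbabilityMeasure_tilted hexp
  have hψi : Integrable ψ (μ.tilted fun x => -ψ x) := by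
    rw [integrable_tilted_iff hexp]
    refine IsBoundedFun.integrable ⟨1, fun x => ?_⟩ (by simp only [smul_eq_mul]; fun_prop)
    simp only [smul_eq_mul]
    rw [abs_of_nonneg (mul_nonneg (Real.exp_pos _).le (hψ0 x)), Real.exp_neg,
      inv_mul_le_one₀ (Real.exp_pos _)]
    linarith [Real.add_one_le_exp (ψ x)]
  have hac : (μ.tilted fun x => -ψ x) ≪ μ := tilted_absolutelyContinuous _ _
  have hllr : Integrable (llr (μ.tilted fun x => -ψ x) μ) (μ.tilted fun x => -ψ x) := by
    refine (hψi.neg.sub (integrable_const (Real.log (∫ x, Real.exp (-ψ x) ∂μ)))).congr ?_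
    exact (hac.ae_eq (log_rnDeriv_tilted_left_self hexp)).symm
  obtain ⟨π, h1, h2, hπ⟩ := hT.exists_coupling hac hllr (ε := 1) one_ne_zero
  rw [← h2, lintegral_map hψ.ennreal_ofReal measurable_snd]
  refine lintegral_cost_ne_top_of_dist hα hΔ measurable_fst x₀ ?_ ?_
  · simp only [dist_comm (Prod.snd _)]
    exact ne_top_of_le_ne_top (by finiteness) hπ
  · rw [← lintegral_map (f := fun x => ENNReal.ofReal (ψ x)) hψ.ennreal_ofReal measurable_fst, h1]
    exact hψi.lintegral_lt_top.ne

/-- Under a transport-entropy inequality, measures of finite relative entropy have a finite cost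
moment. -/
lemma TransportEntropy.lintegral_cost_ne_top_of_integrable_llr (hα : IsYoung α) (hΔ : DeltaTwo α)
    {μ ν : Measure X} [IsProbabilityMeasure μ] [IsProbabilityMeasure ν] {C : ℝ}
    (hT : TransportEntropy μ α C) (hν : ν ≪ μ) (hint : Integrable (llr ν μ) ν) (x₀ : X) :
    ∫⁻ x, ENNReal.ofReal (α (dist x x₀)) ∂ν ≠ ∞ := by
  have hψ := (measurable_cost_left hα x₀).ennreal_ofReal
  obtain ⟨π, h1, h2, hπ⟩ := hT.exists_coupling hν hint (ε := 1) one_ne_zero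
  rw [← h1, lintegral_map hψ measurable_fst]
  refine lintegral_cost_ne_top_of_dist hα hΔ measurable_snd x₀
    (ne_top_of_le_ne_top (by finiteness) hπ) ?_
  rw [← lintegral_map hψ measurable_snd, h2]
  exact hT.lintegral_cost_ne_top hα hΔ x₀

end Moments

theorem transport_entropy_perturbation
    {X : Type*} [MetricSpace X] [CompleteSpace X] [TopologicalSpace.SeparableSpace X]
    [ProperSpace X] [MeasurableSpace X] [BorelSpace X]
    (α : ℝ → ℝ) (hα : IsYoung α) (hΔ : DeltaTwo α)
    (μ : Measure X) [IsProbabilityMeasure μ] (C : ℝ) (hC : 0 < C)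
    (hT : TransportEntropy μ α C)
    (φ : X → ℝ) (hφm : Measurable φ) (hφb : IsBoundedFun φ) :
    TransportEntropy
      (μ.withDensity fun x => ENNReal.ofReal (Real.exp (φ x) / ∫ y, Real.exp (φ y) ∂μ)) α
      ((pAlpha α ^ (pAlpha α * pAlpha α) /
          (pAlpha α - 1) ^ (pAlpha α * (pAlpha α - 1))) * C *
        Real.exp ((pAlpha α - 1) * ((⨆ x, φ x) - ⨅ x, φ x))) := by
  intro ν hνp
  change transportCost α ν (μ.tilted φ) ≤ _ * relEnt ν (μ.tilted φ)
  have hp := hα.one_lt_pAlpha hΔ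
  set p := pAlpha α
  have hp0 : 0 < p := by linarith
  have hq0 : 0 < p - 1 := by linarith
  set K := Real.exp ((⨆ x, φ x) - ⨅ x, φ x) with hKdef
  have hexp : Integrable (fun x => Real.exp (φ x)) μ := hφb.exp.integrable (by fun_prop)
  have := isProbabilityMeasure_tilted hexp
  obtain ⟨x₀⟩ := nonempty_of_isProbabilityMeasure μ
  have hK : 1 ≤ K := by
    obtain ⟨M, hM⟩ := hφb
    refine Real.one_le_exp (sub_nonneg.2 ((ciInf_le ⟨-M, ?_⟩ x₀).trans (le_ciSup ⟨M, ?_⟩ x₀)))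
    · rintro _ ⟨x, rfl⟩; exact (abs_le.1 (hM x)).1
    · rintro _ ⟨x, rfl⟩; exact (abs_le.1 (hM x)).2
  set Ct := p ^ (p * p) / (p - 1) ^ (p * (p - 1)) * C *
    Real.exp ((p - 1) * ((⨆ x, φ x) - ⨅ x, φ x)) with hCt
  have hCt0 : 0 < Ct := by positivity
  by_cases hfin : ν ≪ μ.tilted φ ∧ Integrable (llr ν (μ.tilted φ)) ν
  swap
  · rw [show relEnt ν (μ.tilted φ) = ⊤ from if_neg hfin, ENNReal.mul_top (by simpa using hCt0)]
    exact le_top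
  obtain ⟨hν, hint⟩ := hfin
  rw [relEnt_eq hν hint, ← ENNReal.ofReal_mul hCt0.le]
  have hac : μ.tilted φ ≪ μ := tilted_absolutelyContinuous _ _
  have hνμ : ν ≪ μ := hν.trans hac
  have hint' : Integrable (llr ν μ) ν := by
    have h := llr_tilted_right hνμ hexp
    have h1 := (hint.sub ((hφb.integrable hφm).neg.add
      (integrable_const (Real.log (∫ x, Real.exp (φ x) ∂μ)))))
    refine h1.congr ?_
    filter_upwards [h] with x hx
    simp only [Pi.sub_apply, Pi.add_apply, Pi.neg_apply, hx]
    ring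
  set lam := (p * C)⁻¹ with hlamdef
  have hlam : 0 < lam := by positivity
  have hlamC : lam * C = p⁻¹ := by rw [hlamdef]; field_simp
  have hlamC1 : lam * C < 1 := by rw [hlamC]; exact inv_lt_one_of_one_lt₀ hp
  set A := K / (1 - lam * C) with hAdef
  have hAK : A = K * (p / (p - 1)) := by
    rw [hAdef, hlamC]; field_simp
  have hA : 1 < A := by
    rw [hAK]
    have : 1 < p / (p - 1) := by rw [one_lt_div hq0]; linarith
    nlinarith
  have hLS : ModLogSobolev (μ.tilted φ) α lam A := fun h D hm hb hDm hDb hD0 hD =>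
    hT.logSobolev_tilted hα hC hlam hlamC1 hφm hφb hm hb hDm hDb hD0 hD
  have hH : 0 ≤ ∫ x, llr ν (μ.tilted φ) x ∂ν := by
    simpa using InformationTheory.integral_llr_add_sub_measure_univ_nonneg hν hint
  have hconst : pathTemp A p lam 1 ≤ Ct := by
    refine (pathTemp_one_le hp hlam hK hAK).trans (le_of_eq ?_)
    have h1 : (lam * p)⁻¹ = C := by rw [hlamdef]; field_simp
    rw [h1, hCt, hKdef, ← Real.exp_mul, mul_comm (p - 1)]
  refine transportCost_le_of_dual hα hΔ x₀
    (hT.lintegral_cost_ne_top_of_integrable_llr hα hΔ hνμ hint' x₀)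
    (hT.lintegral_cost_ne_top_of_integrable_llr hα hΔ hac (integrable_llr_tilted_self hφm hφb) x₀)
    fun g hg hgb => (hLS.dual_le hα hΔ hA hlam hν hint hg hgb).trans ?_
  exact mul_le_mul_of_nonneg_right hconst hH
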